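/- Let n ≥ 3 and let C be a real symmetric positive definite n×n matrix with n distinct eigenvalues. Then there exist skew-symmetric n×n matrices G¹ and G² (depending on C) such that the controlled Euler–Frahm system with two torques, given by I_C(Ω̇(t)) = [C, Ω(t)²] − ν·I_C(Ω(t)) + u₁(t)·I_C(G¹) + u₂(t)·I_C(G²) (where I_C(X) = XC + CX, [A,B] = AB − BA, and ν ≥ 0), is globally controllable on the space of skew-symmetric matrices: for every pair of skew-symmetric n×n matrices Ω̃, Ω̂ there exist a time T ≥ 0, piecewise constant control functions u₁, u₂ : [0,T] → ℝ, and a piecewise C¹ curve Ω : [0,T] → (skew-symmetric n×n matrices) solving the system with Ω(0) = Ω̃ and Ω(T) = Ω̂. -/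

import Mathlib

open Matrix Set

/-- Square real matrices of size `n`. -/
abbrev Mat (n : ℕ) := Matrix (Fin n) (Fin n) ℝ

/-- The inertia operator `I_C(X) = XC + CX` of the multidimensional rigid body. -/
def IC {n : ℕ} (C X : Mat n) : Mat n := X * C + C * X

/-- Matrix commutator `[A, B] = AB - BA`. -/
def mbracket {n : ℕ} (A B : Mat n) : Mat n := A * B - B * A

/-- A matrix is skew-symmetric, i.e. belongs to `so(n)`. -/
def IsSkew {n : ℕ} (X : Mat n) : Prop := Xᵀ = -X

/-- `Steers C ν G Ω₀ Ω₁` : there are a time `T ≥ 0`, piecewise constant controls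
`u j : [0,T] → ℝ` and a piecewise `C¹` curve `Ω : [0,T] → so(n)` with `Ω 0 = Ω₀`,
`Ω T = Ω₁`, solving the controlled damped Euler–Frahm equation
`I_C(Ω̇) = [C, Ω²] − ν I_C(Ω) + Σⱼ uⱼ(t) I_C(Gʲ)` on each subinterval of constancy. -/
def Steers {n m : ℕ} (C : Mat n) (ν : ℝ) (G : Fin m → Mat n) (Ω₀ Ω₁ : Mat n) : Prop :=
  ∃ (T : ℝ) (u : Fin m → ℝ → ℝ) (Ω : ℝ → Mat n) (k : ℕ) (t : ℕ → ℝ),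
    0 ≤ T ∧ t 0 = 0 ∧ t k = T ∧
    (∀ i, i < k → t i < t (i + 1)) ∧
    ContinuousOn Ω (Icc 0 T) ∧
    (∀ s ∈ Icc (0 : ℝ) T, IsSkew (Ω s)) ∧
    Ω 0 = Ω₀ ∧ Ω T = Ω₁ ∧
    (∀ i, i < k → ∀ j : Fin m, ∃ c : ℝ, ∀ s ∈ Ioo (t i) (t (i + 1)), u j s = c) ∧
    (∀ i, i < k → ∀ s ∈ Ioo (t i) (t (i + 1)), ∃ D : Mat n,
      (∀ p q : Fin n, HasDerivAt (fun τ => Ω τ p q) (D p q) s) ∧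
      IC C D = mbracket C ((Ω s) ^ 2) - ν • IC C (Ω s) + ∑ j, u j s • IC C (G j))

namespace MRB

open Filter Topology

section ODE

variable {E : Type*} [NormedAddCommGroup E] [NormedSpace ℝ E]

/-- `γ` solves the autonomous equation `γ' = F γ` on `[0,1]`. -/
def Sol (F : E → E) (γ : ℝ → E) : Prop :=
  ∀ t ∈ Icc (0 : ℝ) 1, HasDerivWithinAt γ (F (γ t)) (Icc 0 1) t

lemma Sol.continuousOn {F : E → E} {γ : ℝ → E} (h : Sol F γ) : ContinuousOn γ (Icc 0 1) :=
  fun t ht => (h t ht).continuousWithinAt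

lemma derivIci {γ : ℝ → E} {e : E} {t : ℝ} (ht : t ∈ Ico (0 : ℝ) 1)
    (h : HasDerivWithinAt γ e (Icc 0 1) t) : HasDerivWithinAt γ e (Ici t) t := by
  apply h.mono_of_mem_nhdsWithin
  have : Icc t 1 ∈ 𝓝[Ici t] t := Icc_mem_nhdsGE ht.2
  exact mem_of_superset this (Icc_subset_Icc ht.1 le_rfl)

lemma derivIic {γ : ℝ → E} {e : E} {t : ℝ} (ht : t ∈ Ioc (0 : ℝ) 1)
    (h : HasDerivWithinAt γ e (Icc 0 1) t) : HasDerivWithinAt γ e (Iic t) t := by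
  apply h.mono_of_mem_nhdsWithin
  have : Icc 0 t ∈ 𝓝[Iic t] t := Icc_mem_nhdsLE ht.1
  exact mem_of_superset this (Icc_subset_Icc le_rfl ht.2)

/-- Global existence on `[0,1]` for globally Lipschitz time dependent fields. -/
theorem exists_global [FiniteDimensional ℝ E] (v : ℝ → E → E) (K : NNReal)
    (hK : ∀ t ∈ Icc (0 : ℝ) 1, LipschitzWith K (v t))
    (hc : ∀ x, ContinuousOn (fun t => v t x) (Icc (0 : ℝ) 1)) (x0 : E) :
    ∃ γ : ℝ → E, γ 0 = x0 ∧
      ∀ t ∈ Icc (0 : ℝ) 1, HasDerivWithinAt γ (v t (γ t)) (Icc (0 : ℝ) 1) t := by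
  have : CompleteSpace E := FiniteDimensional.complete ℝ E
  obtain ⟨C, hC⟩ := isCompact_Icc.exists_bound_of_continuousOn (hc x0)
  have hC0 : 0 ≤ C := (norm_nonneg _).trans (hC 0 (by simp))
  set R : ℝ := gronwallBound 0 K C 1 with hR
  have hR0 : 0 ≤ R := by
    have := gronwallBound_mono (le_refl (0 : ℝ)) hC0 K.2 (zero_le_one' ℝ)
    rwa [gronwallBound_x0] at this
  let χ : ContDiffBump x0 := ⟨R + 1, R + 2, by linarith, by linarith⟩
  obtain ⟨Kχ, hKχ⟩ := χ.contDiff.lipschitzWith_of_hasCompactSupport (n := 1) (𝕂 := ℝ)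
    χ.hasCompactSupport (by norm_num)
  have hv : ∀ t ∈ Icc (0 : ℝ) 1, ∀ x, ‖v t x‖ ≤ K * ‖x - x0‖ + C := by
    intro t ht x
    have h1 := (hK t ht).dist_le_mul x x0
    rw [dist_eq_norm, dist_eq_norm] at h1
    have h2 := hC t ht
    have : v t x = (v t x - v t x0) + v t x0 := by abel
    rw [this]
    exact (norm_add_le _ _).trans (add_le_add h1 h2)
  let L : NNReal := ⟨K * (R + 2) + C, by positivity⟩
  let B : NNReal := ⟨K * L + C, by positivity⟩
  have hPL : IsPicardLindelof (fun t x => χ x • v t x) (tmin := 0) (tmax := 1)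
      ⟨0, by simp⟩ x0 L 0 L (K + Kχ * B) := by
    constructor
    · intro t ht
      apply LipschitzOnWith.of_dist_le_mul
      intro x hx y hy
      rw [dist_eq_norm, dist_eq_norm]
      have e : χ x • v t x - χ y • v t y = χ x • (v t x - v t y) + (χ x - χ y) • v t y := by
        rw [smul_sub, sub_smul]; abel
      rw [e]
      refine (norm_add_le _ _).trans ?_
      rw [norm_smul, norm_smul]
      have h1 := (hK t ht).dist_le_mul x y
      rw [dist_eq_norm, dist_eq_norm] at h1
      have h2 := hKχ.dist_le_mul x y
      rw [dist_eq_norm, dist_eq_norm] at h2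
      have h3 : ‖v t y‖ ≤ B := by
        refine (hv t ht y).trans ?_
        have : ‖y - x0‖ ≤ L := by simpa [dist_eq_norm] using hy
        change _ ≤ (K : ℝ) * L + C
        gcongr
      have h4 : ‖χ x‖ ≤ 1 := by
        rw [Real.norm_eq_abs, abs_of_nonneg χ.nonneg]; exact χ.le_one
      have h5 : ‖χ x‖ * ‖v t x - v t y‖ ≤ 1 * (K * ‖x - y‖) := by gcongr
      have h6 : ‖χ x - χ y‖ * ‖v t y‖ ≤ (Kχ * ‖x - y‖) * B := by gcongr
      push_cast
      nlinarith
    · intro x _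
      exact (hc x).const_smul _
    · intro t ht x _
      rw [norm_smul, Real.norm_eq_abs, abs_of_nonneg χ.nonneg]
      by_cases h : R + 2 ≤ dist x x0
      · rw [χ.zero_of_le_dist h]; simp
      · push Not at h
        rw [dist_eq_norm] at h
        have h1 := hv t ht x
        have h2 : χ x * ‖v t x‖ ≤ 1 * ‖v t x‖ := by gcongr; exact χ.le_one
        have h3 : (K : ℝ) * ‖x - x0‖ + C ≤ K * (R + 2) + C := by gcongr
        change _ ≤ (K : ℝ) * (R + 2) + C
        linarith
    · simp
  obtain ⟨γ, h0, hγ⟩ := hPL.exists_eq_forall_mem_Icc_hasDerivWithinAt₀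
  simp only at h0
  refine ⟨γ, h0, fun t ht => ?_⟩
  have hb := norm_le_gronwallBound_of_norm_deriv_right_le (f := fun t => γ t - x0)
    (f' := fun t => χ (γ t) • v t (γ t)) (δ := 0) (K := K) (ε := C) (a := 0) (b := 1)
    (fun t ht => ((hγ t ht).continuousWithinAt).sub continuousWithinAt_const)
    (fun t ht => (derivIci ht (hγ t ⟨ht.1, ht.2.le⟩)).sub_const _)
    (by simp [h0])
    (by
      intro t ht
      rw [norm_smul, Real.norm_eq_abs, abs_of_nonneg χ.nonneg]
      have h1 := hv t ⟨ht.1, ht.2.le⟩ (γ t)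
      have h2 : χ (γ t) * ‖v t (γ t)‖ ≤ 1 * ‖v t (γ t)‖ := by gcongr; exact χ.le_one
      linarith) t ht
  have h1 : χ (γ t) = 1 := by
    apply χ.one_of_mem_closedBall
    change dist _ _ ≤ R + 1
    rw [dist_eq_norm]
    have := gronwallBound_mono (le_refl (0 : ℝ)) hC0 K.2 (show t - 0 ≤ 1 by linarith [ht.2])
    have h3 : ‖γ t - x0‖ ≤ R := hb.trans this
    linarith
  have := hγ t ht
  simpa [h1] using this

/-- Differentiable dependence on initial data for `C¹` autonomous fields. -/
theorem flow_diff [FiniteDimensional ℝ E] {F : E → E} (hF : ContDiff ℝ 1 F) {γ : ℝ → E}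
    (hγ : Sol F γ) :
    ∃ (Φ : E → E) (M : ℝ → E →L[ℝ] E), M 0 = ContinuousLinearMap.id ℝ E ∧
      (∀ t ∈ Icc (0 : ℝ) 1,
        HasDerivWithinAt M ((fderiv ℝ F (γ t)).comp (M t)) (Icc (0 : ℝ) 1) t) ∧
      Function.Injective (M 1) ∧
      HasStrictFDerivAt Φ (M 1) (γ 0) ∧ Φ (γ 0) = γ 1 ∧
      ∀ᶠ x in 𝓝 (γ 0), ∃ σ, Sol F σ ∧ σ 0 = x ∧ σ 1 = Φ x := by
  have : CompleteSpace E := FiniteDimensional.complete ℝ E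
  have : ProperSpace E := FiniteDimensional.proper ℝ E
  obtain ⟨R, hR⟩ := isCompact_Icc.exists_bound_of_continuousOn hγ.continuousOn
  have hR0 : 0 ≤ R := (norm_nonneg _).trans (hR 0 (by simp))
  let χ : ContDiffBump (0 : E) := ⟨R + 1, R + 2, by linarith, by linarith⟩
  set Fc : E → E := fun x => χ x • F x with hFc
  have hFcd : ContDiff ℝ 1 Fc := χ.contDiff.smul hF
  have hFcs : HasCompactSupport Fc := χ.hasCompactSupport.smul_right
  obtain ⟨K, hK⟩ := hFcd.lipschitzWith_of_hasCompactSupport hFcs (by norm_num)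
  have hFeq : ∀ x, ‖x‖ ≤ R + 1 → Fc x = F x := by
    intro x hx
    have : χ x = 1 := χ.one_of_mem_closedBall (by simpa using hx)
    simp [hFc, this]
  have hγc : Sol Fc γ := by
    intro t ht
    rw [hFeq _ (by linarith [hR t ht])]
    exact hγ t ht
  have hex : ∀ x, ∃ σ : ℝ → E, σ 0 = x ∧ Sol Fc σ := fun x =>
    exists_global (fun _ => Fc) K (fun _ _ => hK) (fun _ => continuousOn_const) x
  choose σ hσ0 hσ using hex
  have hdist : ∀ (α β : ℝ → E), Sol Fc α → Sol Fc β → ∀ t ∈ Icc (0 : ℝ) 1,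
      dist (α t) (β t) ≤ dist (α 0) (β 0) * Real.exp K := by
    intro α β hα hβ t ht
    have := dist_le_of_trajectories_ODE (v := fun _ => Fc) (fun _ => hK) hα.continuousOn
      (fun t ht => derivIci ht (hα t ⟨ht.1, ht.2.le⟩)) hβ.continuousOn
      (fun t ht => derivIci ht (hβ t ⟨ht.1, ht.2.le⟩)) le_rfl t ht
    refine this.trans ?_
    gcongr
    have := ht.2
    have hK0 : (0 : ℝ) ≤ K := K.2
    nlinarith
  have hσγ : ∀ t ∈ Icc (0 : ℝ) 1, σ (γ 0) t = γ t := by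
    intro t ht
    have := hdist _ _ (hσ (γ 0)) hγc t ht
    rw [hσ0] at this
    simpa using this
  -- the linearised flow
  have hdF : Continuous (fderiv ℝ F) := hF.continuous_fderiv (by norm_num)
  have hAc : ContinuousOn (fun t => fderiv ℝ F (γ t)) (Icc 0 1) :=
    hdF.comp_continuousOn hγ.continuousOn
  obtain ⟨K1', hK1'⟩ := isCompact_Icc.exists_bound_of_continuousOn hAc
  have hK10 : 0 ≤ K1' := (norm_nonneg _).trans (hK1' 0 (by simp))
  let K1 : NNReal := ⟨K1' + 1, by linarith⟩
  have hK1 : ∀ t ∈ Icc (0 : ℝ) 1, ‖fderiv ℝ F (γ t)‖ ≤ K1 := fun t ht =>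
    (hK1' t ht).trans (by change K1' ≤ K1' + 1; linarith)
  have hK1pos : (0 : ℝ) < K1 := by change 0 < K1' + 1; linarith
  obtain ⟨M, hM0, hM⟩ := exists_global (fun t (N : E →L[ℝ] E) => (fderiv ℝ F (γ t)).comp N) K1
    (by
      intro t ht
      apply LipschitzWith.of_dist_le_mul
      intro N N'
      rw [dist_eq_norm, dist_eq_norm, ← ContinuousLinearMap.comp_sub]
      refine (ContinuousLinearMap.opNorm_comp_le _ _).trans ?_
      gcongr
      exact hK1 t ht)
    (fun N => hAc.clm_comp continuousOn_const) (ContinuousLinearMap.id ℝ E)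
  have hMx : ∀ ξ, ∀ t ∈ Icc (0 : ℝ) 1,
      HasDerivWithinAt (fun t => M t ξ) (fderiv ℝ F (γ t) (M t ξ)) (Icc 0 1) t := by
    intro ξ t ht
    have := (hM t ht).clm_apply (hasDerivWithinAt_const t (Icc (0 : ℝ) 1) ξ)
    simpa using this
  refine ⟨fun x => σ x 1, M, hM0, hM, ?_, ?_, ?_, ?_⟩
  · rw [injective_iff_map_eq_zero]
    intro ξ hξ
    have := ODE_solution_unique_of_mem_Icc_left (v := fun t x => fderiv ℝ F (γ t) x)
      (s := fun _ => univ) (K := K1) (f := fun t => M t ξ) (g := fun _ => 0) (a := 0) (b := 1)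
      (by
        intro t ht
        apply LipschitzWith.lipschitzOnWith
        exact ((fderiv ℝ F (γ t)).lipschitz).weaken (hK1 t ⟨ht.1.le, ht.2⟩))
      (fun t ht => (hMx ξ t ht).continuousWithinAt)
      (fun t ht => derivIic ht (hMx ξ t ⟨ht.1.le, ht.2⟩))
      (fun _ _ => mem_univ _) continuousOn_const
      (fun t ht => by simpa using hasDerivWithinAt_const t (Iic t) (0 : E))
      (fun _ _ => mem_univ _) hξ
    have h := this (show (0 : ℝ) ∈ Icc (0 : ℝ) 1 by simp)
    simpa [hM0] using h
  · rw [hasStrictFDerivAt_iff_isLittleO, Asymptotics.isLittleO_iff]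
    intro c hc
    set Q : ℝ := Real.exp K / K1 * (Real.exp K1 - 1) with hQ
    have hexp : 0 < Real.exp K1 - 1 := by
      have := Real.add_one_lt_exp hK1pos.ne'
      linarith
    have hQ0 : 0 < Q := by positivity
    set ε : ℝ := c / Q with hε
    have hε0 : 0 < ε := by positivity
    have huc := (isCompact_closedBall (0 : E) (R + 1)).uniformContinuousOn_of_continuous
      hdF.continuousOn
    rw [Metric.uniformContinuousOn_iff] at huc
    obtain ⟨η, hη0, hη⟩ := huc ε hε0
    set ρ : ℝ := min η 1 / Real.exp K / 1 with hρ
    have hρ0 : 0 < ρ := by positivity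
    have hrem : ∀ t ∈ Icc (0 : ℝ) 1, ∀ a ∈ Metric.ball (γ t) (min η 1),
        ∀ b ∈ Metric.ball (γ t) (min η 1),
        ‖F a - F b - fderiv ℝ F (γ t) (a - b)‖ ≤ ε * ‖a - b‖ := by
      intro t ht a ha b hb
      apply Convex.norm_image_sub_le_of_norm_fderiv_le' (s := Metric.ball (γ t) (min η 1))
        (fun x _ => (hF.differentiable (by norm_num)) x) _ (convex_ball _ _) hb ha
      intro x hx
      rw [Metric.mem_ball] at hx
      have h1 : x ∈ Metric.closedBall (0 : E) (R + 1) := by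
        rw [mem_closedBall_zero_iff]
        have h3 := hR t ht
        have h4 : ‖x - γ t‖ < 1 := by
          rw [← dist_eq_norm]; exact hx.trans_le (min_le_right _ _)
        have : x = (x - γ t) + γ t := by abel
        rw [this]
        linarith [norm_add_le (x - γ t) (γ t)]
      have h2 : γ t ∈ Metric.closedBall (0 : E) (R + 1) := by
        rw [mem_closedBall_zero_iff]; linarith [hR t ht]
      have := hη x h1 (γ t) h2 (hx.trans_le (min_le_left _ _))
      rw [dist_eq_norm] at this
      exact this.le
    have hnear : ∀ x ∈ Metric.ball (γ 0) ρ, ∀ t ∈ Icc (0 : ℝ) 1,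
        σ x t ∈ Metric.ball (γ t) (min η 1) := by
      intro x hx t ht
      have := hdist _ _ (hσ x) hγc t ht
      rw [hσ0] at this
      rw [Metric.mem_ball] at hx ⊢
      refine this.trans_lt ?_
      rw [hρ, div_one, lt_div_iff₀ (Real.exp_pos _)] at hx
      exact hx
    have hnh : Metric.ball (γ 0) ρ ×ˢ Metric.ball (γ 0) ρ ∈ 𝓝 (γ 0, γ 0) :=
      prod_mem_nhds (Metric.ball_mem_nhds _ hρ0) (Metric.ball_mem_nhds _ hρ0)
    filter_upwards [hnh]
    rintro ⟨x, y⟩ ⟨hx, hy⟩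
    simp only
    have hb := norm_le_gronwallBound_of_norm_deriv_right_le
      (f := fun t => σ x t - σ y t - M t (x - y))
      (f' := fun t => Fc (σ x t) - Fc (σ y t) - fderiv ℝ F (γ t) (M t (x - y)))
      (δ := 0) (K := K1) (ε := ε * (dist x y * Real.exp K)) (a := 0) (b := 1)
      (fun t ht => (((hσ x t ht).sub (hσ y t ht)).sub (hMx (x - y) t ht)).continuousWithinAt)
      (fun t ht => derivIci ht (((hσ x t ⟨ht.1, ht.2.le⟩).sub
        (hσ y t ⟨ht.1, ht.2.le⟩)).sub (hMx (x - y) t ⟨ht.1, ht.2.le⟩)))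
      (by simp [hσ0, hM0])
      (by
        intro t ht
        have ht' : t ∈ Icc (0 : ℝ) 1 := ⟨ht.1, ht.2.le⟩
        have hsmall : ∀ z ∈ Metric.ball (γ t) (min η 1), Fc z = F z := by
          intro z hz
          apply hFeq
          have h3 := hR t ht'
          have h4 : ‖z - γ t‖ < 1 := by
            rw [← dist_eq_norm]; exact (Metric.mem_ball.1 hz).trans_le (min_le_right _ _)
          have : z = (z - γ t) + γ t := by abel
          rw [this]
          linarith [norm_add_le (z - γ t) (γ t)]
        rw [hsmall _ (hnear x hx t ht'), hsmall _ (hnear y hy t ht')]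
        have h1 := hrem t ht' _ (hnear x hx t ht') _ (hnear y hy t ht')
        have h2 := hdist _ _ (hσ x) (hσ y) t ht'
        rw [hσ0, hσ0, dist_eq_norm] at h2
        have e : F (σ x t) - F (σ y t) - fderiv ℝ F (γ t) (M t (x - y)) =
            fderiv ℝ F (γ t) (σ x t - σ y t - M t (x - y)) +
            (F (σ x t) - F (σ y t) - fderiv ℝ F (γ t) (σ x t - σ y t)) := by
          rw [map_sub (fderiv ℝ F (γ t)) (σ x t - σ y t)]; abel
        rw [e]
        refine (norm_add_le _ _).trans ?_
        have h3 := (fderiv ℝ F (γ t)).le_opNorm (σ x t - σ y t - M t (x - y))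
        have h4 : ‖fderiv ℝ F (γ t)‖ * ‖σ x t - σ y t - M t (x - y)‖ ≤
          K1 * ‖σ x t - σ y t - M t (x - y)‖ := by gcongr; exact hK1 t ht'
        have h5 : ε * ‖σ x t - σ y t‖ ≤ ε * (dist x y * Real.exp K) := by gcongr
        linarith) 1 (by simp)
    refine hb.trans (le_of_eq ?_)
    rw [gronwallBound_of_K_ne_0 hK1pos.ne', ← dist_eq_norm]
    have : c = ε * Q := by rw [hε]; field_simp
    rw [this, hQ]
    simp
    ring
  · exact hσγ 1 (by simp)
  · have : Metric.ball (γ 0) (1 / Real.exp K) ∈ 𝓝 (γ 0) :=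
      Metric.ball_mem_nhds _ (by positivity)
    filter_upwards [this] with x hx
    refine ⟨σ x, ?_, hσ0 x, rfl⟩
    intro t ht
    have h1 := hdist _ _ (hσ x) hγc t ht
    rw [hσ0] at h1
    rw [Metric.mem_ball, lt_div_iff₀ (Real.exp_pos _)] at hx
    have h2 : ‖σ x t‖ ≤ R + 1 := by
      have : σ x t = (σ x t - γ t) + γ t := by abel
      rw [this]
      rw [dist_eq_norm] at h1
      linarith [norm_add_le (σ x t - γ t) (γ t), hR t ht]
    rw [← hFeq _ h2]
    exact hσ x t ht

end ODE

end MRB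

namespace MRB

open Filter Topology

section Density

variable {X : Type*} [NormedAddCommGroup X] [NormedSpace ℝ X]

/-- One step of the control system: constant control `u ∈ U` during time `τ`,
time being rescaled to `[0,1]`. -/
def Step (f : X → X) (U : Submodule ℝ X) (x y : X) : Prop :=
  ∃ τ : ℝ, 0 < τ ∧ ∃ u ∈ U, ∃ γ : ℝ → X, Sol (fun z => τ • (f z + u)) γ ∧ γ 0 = x ∧ γ 1 = y

/-- Reachability by piecewise constant controls. -/
def Reach (f : X → X) (U : Submodule ℝ X) : X → X → Prop := Relation.ReflTransGen (Step f U)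

/-- Approximate reachability. -/
def ClR (f : X → X) (U : Submodule ℝ X) (x y : X) : Prop := y ∈ closure {z | Reach f U x z}

lemma f_shift {f : X → X} {B : X →ₗ[ℝ] X →ₗ[ℝ] X} {A : X →ₗ[ℝ] X}
    (hB : ∀ x y, B x y = B y x) (hfB : ∀ x, f x = B x x + A x) (y w : X) (s : ℝ) :
    f (y + s • w) = f y + s • ((2 : ℝ) • B y w + A w) + (s ^ 2) • B w w := by
  rw [hfB, hfB]
  simp only [map_add, map_smul, LinearMap.add_apply, LinearMap.smul_apply, hB w y]
  module

variable {P : Type*} [NormedAddCommGroup P] [NormedSpace ℝ P]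

lemma sol_param_snd {G : X × P → X} {σ : ℝ → X × P} (h : Sol (fun p => (G p, (0 : P))) σ) :
    ∀ t ∈ Icc (0 : ℝ) 1, (σ t).2 = (σ 0).2 := by
  have hd : ∀ t ∈ Icc (0 : ℝ) 1, HasDerivWithinAt (fun t => (σ t).2) 0 (Icc 0 1) t :=
    fun t ht => (h t ht).snd
  exact constant_of_has_deriv_right_zero (fun t ht => (hd t ht).continuousWithinAt)
    (fun t ht => derivIci ht (hd t ⟨ht.1, ht.2.le⟩))

lemma sol_param {G : X × P → X} {σ : ℝ → X × P} (h : Sol (fun p => (G p, (0 : P))) σ) :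
    Sol (fun z => G (z, (σ 0).2)) (fun t => (σ t).1) := by
  intro t ht
  have h1 := (h t ht).fst
  rw [← sol_param_snd h t ht]
  exact h1

lemma sol_param_mk {G : X × P → X} {γ : ℝ → X} {η : P} (h : Sol (fun z => G (z, η)) γ) :
    Sol (fun p => (G p, (0 : P))) (fun t => (γ t, η)) :=
  fun t ht => (h t ht).prodMk (hasDerivWithinAt_const _ _ _)

lemma flow_param [FiniteDimensional ℝ X] [FiniteDimensional ℝ P] {G : X × P → X}
    (hG : ContDiff ℝ 1 G) {γ : ℝ → X} {η₀ : P}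
    (hγ : Sol (fun z => G (z, η₀)) γ) {N : Set X} (hN : N ∈ 𝓝 (γ 1)) :
    ∀ᶠ p in 𝓝 (γ 0, η₀), ∃ σ, Sol (fun z => G (z, p.2)) σ ∧ σ 0 = p.1 ∧ σ 1 ∈ N := by
  have hF : ContDiff ℝ 1 (fun p : X × P => (G p, (0 : P))) := hG.prodMk contDiff_const
  obtain ⟨Φ, M, -, -, -, hΦ, hΦ1, hev⟩ := flow_diff hF (sol_param_mk hγ)
  have hc : Tendsto Φ (𝓝 (γ 0, η₀)) (𝓝 (γ 1, η₀)) := by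
    have := hΦ.continuousAt
    rw [ContinuousAt, hΦ1] at this
    exact this
  have hN' : Prod.fst ⁻¹' N ∈ 𝓝 (γ 1, η₀) := continuous_fst.continuousAt hN
  filter_upwards [hev, hc hN'] with p ⟨σ, hσ, h0, h1⟩ hp
  refine ⟨fun t => (σ t).1, ?_, congrArg Prod.fst h0, ?_⟩
  · have := sol_param hσ
    rwa [h0] at this
  · simp only [h1]; exact hp

variable [FiniteDimensional ℝ X] {f : X → X} {U : Submodule ℝ X}

lemma step_cont (hf : ContDiff ℝ 1 f) {x y : X} (h : Step f U x y) {N : Set X} (hN : N ∈ 𝓝 y) :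
    ∀ᶠ x' in 𝓝 x, ∃ y' ∈ N, Step f U x' y' := by
  obtain ⟨τ, hτ, u, hu, γ, hγ, rfl, rfl⟩ := h
  obtain ⟨Φ, M, -, -, -, hΦ, hΦ1, hev⟩ := flow_diff (F := fun z => τ • (f z + u))
    ((hf.add contDiff_const).const_smul τ) hγ
  have hc : Tendsto Φ (𝓝 (γ 0)) (𝓝 (γ 1)) := by
    have := hΦ.continuousAt
    rwa [ContinuousAt, hΦ1] at this
  filter_upwards [hev, hc hN] with x' ⟨σ, hσ, h0, h1⟩ hx'
  exact ⟨σ 1, by rw [h1]; exact hx', τ, hτ, u, hu, σ, hσ, h0, rfl⟩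

lemma reach_cont (hf : ContDiff ℝ 1 f) {x y : X} (h : Reach f U x y) {N : Set X} (hN : N ∈ 𝓝 y) :
    ∀ᶠ x' in 𝓝 x, ∃ y' ∈ N, Reach f U x' y' := by
  induction h using Relation.ReflTransGen.head_induction_on with
  | refl => exact mem_of_superset hN (fun x' hx' => ⟨x', hx', Relation.ReflTransGen.refl⟩)
  | head hxc _ ih =>
    filter_upwards [step_cont hf hxc ih] with x' ⟨y', hy', hs⟩
    obtain ⟨z, hz, hr⟩ := hy'
    exact ⟨z, hz, Relation.ReflTransGen.head hs hr⟩

lemma ClR.refl (x : X) : ClR f U x x := subset_closure Relation.ReflTransGen.refl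

lemma Reach.clR {x y : X} (h : Reach f U x y) : ClR f U x y := subset_closure h

lemma Step.clR {x y : X} (h : Step f U x y) : ClR f U x y :=
  subset_closure (Relation.ReflTransGen.single h)

lemma ClR.trans (hf : ContDiff ℝ 1 f) {x y z : X} (h1 : ClR f U x y) (h2 : ClR f U y z) :
    ClR f U x z := by
  have h1' : y ∈ closure {z | Reach f U x z} := h1
  have h2' : z ∈ closure {w | Reach f U y w} := h2
  change z ∈ closure {w | Reach f U x w}
  rw [mem_closure_iff_nhds] at h1' h2' ⊢
  intro N hN
  obtain ⟨O, hON, hO, hzO⟩ := mem_nhds_iff.1 hN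
  obtain ⟨w, hwN, hw⟩ := h2' O (hO.mem_nhds hzO)
  obtain ⟨y', hy', hxy'⟩ := h1' _ (reach_cont hf hw (hO.mem_nhds hwN))
  obtain ⟨w', hw', hr⟩ := hy'
  exact ⟨w', hON hw', Relation.ReflTransGen.trans hxy' hr⟩

lemma clR_of_forall {x y : X} (h : ∀ N ∈ 𝓝 y, ∃ z ∈ N, ClR f U x z) : ClR f U x y := by
  have : y ∈ closure {z | ClR f U x z} := by
    rw [mem_closure_iff_nhds]
    intro N hN
    obtain ⟨z, hz, hr⟩ := h N hN
    exact ⟨z, hz, hr⟩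
  have hcl : IsClosed {z | ClR f U x z} := isClosed_closure
  rwa [hcl.closure_eq] at this

lemma clR_of_tendsto {x y : X} {g : ℕ → X} (h : ∀ n : ℕ, ClR f U x (g n))
    (hg : Tendsto g atTop (𝓝 y)) : ClR f U x y := by
  apply clR_of_forall
  intro N hN
  obtain ⟨n, hn⟩ := (hg.eventually hN).exists
  exact ⟨g n, hn, h n⟩

lemma sol_line (x v : X) : Sol (fun _ => v) (fun t => x + t • v) := by
  intro t _
  have := ((hasDerivWithinAt_id t (Icc (0 : ℝ) 1)).smul_const v).const_add x
  simpa using this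

lemma exists_small {p : ℝ → Prop} (h : ∀ᶠ η in 𝓝 (0 : ℝ), p η) : ∃ η, 0 < η ∧ p η := by
  have h1 : ∀ᶠ η in 𝓝[>] (0 : ℝ), p η := h.filter_mono nhdsWithin_le_nhds
  obtain ⟨η, h2, h3⟩ := (h1.and self_mem_nhdsWithin).exists
  exact ⟨η, h3, h2⟩

/-- large controls produce jumps in the directions of `U` -/
lemma clR_jump (hf : ContDiff ℝ 1 f) (x : X) {u : X} (hu : u ∈ U) : ClR f U x (x + u) := by
  apply clR_of_forall
  intro N hN
  have hG : ContDiff ℝ 1 (fun p : X × ℝ => p.2 • f p.1 + u) := by fun_prop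
  have h0 : Sol (fun z => (fun p : X × ℝ => p.2 • f p.1 + u) (z, (0 : ℝ)))
      (fun t => x + t • u) := by
    simpa using sol_line x u
  have hev := flow_param hG h0 (N := N) (by simpa using hN)
  have hev2 : ∀ᶠ η in 𝓝 (0 : ℝ), ∃ σ, Sol (fun z => η • f z + u) σ ∧ σ 0 = x ∧ σ 1 ∈ N := by
    have hc : Tendsto (fun η : ℝ => (x, η)) (𝓝 0) (𝓝 (x + (0 : ℝ) • u, 0)) := by
      have : Continuous (fun η : ℝ => (x, η)) := by fun_prop
      simpa using this.tendsto 0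
    exact hc hev
  obtain ⟨η, hη, σ, hσ, h0, h1⟩ := exists_small hev2
  refine ⟨σ 1, h1, Step.clR ⟨η, hη, η⁻¹ • u, U.smul_mem _ hu, σ, ?_, h0, rfl⟩⟩
  have e : (fun z => η • (f z + η⁻¹ • u)) = fun z => η • f z + u := by
    funext z
    rw [smul_add, smul_smul, mul_inv_cancel₀ hη.ne', one_smul]
  rw [e]; exact hσ

/-- The directions along which one can (approximately) move freely. -/
def freeDir (hf : ContDiff ℝ 1 f) (U : Submodule ℝ X) : Submodule ℝ X where
  carrier := {v | ∀ (x : X) (t : ℝ), ClR f U x (x + t • v)}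
  zero_mem' := by
    intro x t
    simpa using ClR.refl x
  add_mem' := by
    intro a b ha hb x t
    have := (ha x t).trans hf (hb _ t)
    rwa [add_assoc, ← smul_add] at this
  smul_mem' := by
    intro c v hv x t
    rw [smul_smul]
    exact hv x _

lemma le_freeDir (hf : ContDiff ℝ 1 f) : U ≤ freeDir hf U :=
  fun _ hu x t => clR_jump hf x (U.smul_mem t hu)

variable {B : X →ₗ[ℝ] X →ₗ[ℝ] X} {A : X →ₗ[ℝ] X}

lemma clR_quad (hf : ContDiff ℝ 1 f) (hB : ∀ x y, B x y = B y x)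
    (hfB : ∀ x, f x = B x x + A x) {w : X} (hw : w ∈ freeDir hf U) (x : X) {t : ℝ}
    (ht : 0 < t) : ClR f U x (x + t • B w w) := by
  apply clR_of_forall
  intro N hN
  have hBw : ContDiff ℝ 1 (fun y => B y w) :=
    (LinearMap.toContinuousLinearMap (B.flip w)).contDiff
  have hG : ContDiff ℝ 1 (fun p : X × ℝ =>
      t • (B w w + p.2 • ((2 : ℝ) • B p.1 w + A w) + p.2 ^ 2 • f p.1)) := by
    have h1 : ContDiff ℝ 1 (fun p : X × ℝ => B p.1 w) := hBw.comp contDiff_fst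
    have h2 : ContDiff ℝ 1 (fun p : X × ℝ => f p.1) := hf.comp contDiff_fst
    exact ((contDiff_const.add (contDiff_snd.smul ((h1.const_smul (2 : ℝ)).add
      contDiff_const))).add ((contDiff_snd.pow 2).smul h2)).const_smul t
  have h0 : Sol (fun z => (fun p : X × ℝ =>
      t • (B w w + p.2 • ((2 : ℝ) • B p.1 w + A w) + p.2 ^ 2 • f p.1)) (z, (0 : ℝ)))
      (fun s => x + s • (t • B w w)) := by
    simpa using sol_line x (t • B w w)
  have hev := flow_param hG h0 (N := N) (by simpa using hN)
  have hev2 : ∀ᶠ η in 𝓝 (0 : ℝ), ∃ σ, Sol (fun z =>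
      t • (B w w + η • ((2 : ℝ) • B z w + A w) + η ^ 2 • f z)) σ ∧ σ 0 = x ∧ σ 1 ∈ N := by
    have hc : Tendsto (fun η : ℝ => (x, η)) (𝓝 0) (𝓝 (x + (0 : ℝ) • (t • B w w), 0)) := by
      have : Continuous (fun η : ℝ => (x, η)) := by fun_prop
      simpa using this.tendsto 0
    exact hc hev
  obtain ⟨η, hη, σ, hσ, h0, h1⟩ := exists_small hev2
  refine ⟨σ 1, h1, ?_⟩
  have s1 : ClR f U x (x + η⁻¹ • w) := hw x _
  have s2 : ClR f U (x + η⁻¹ • w) (σ 1 + η⁻¹ • w) := by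
    apply Step.clR
    refine ⟨t * η ^ 2, by positivity, 0, U.zero_mem, fun s => σ s + η⁻¹ • w, ?_, by simp [h0], rfl⟩
    intro s hs
    have := (hσ s hs).add_const (η⁻¹ • w)
    convert this using 1
    change (t * η ^ 2) • (f (σ s + η⁻¹ • w) + 0) =
      t • (B w w + η • ((2 : ℝ) • B (σ s) w + A w) + η ^ 2 • f (σ s))
    rw [f_shift hB hfB, add_zero]
    simp only [smul_add, smul_smul]
    have e1 : t * η ^ 2 * η⁻¹ = t * η := by field_simp
    have e2 : t * η ^ 2 * η⁻¹ ^ 2 = t := by field_simp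
    rw [e2]
    rw [show t * η ^ 2 * (η⁻¹ * 2) = t * (η * 2) by field_simp, e1]
    module
  have s3 : ClR f U (σ 1 + η⁻¹ • w) (σ 1) := by
    have := hw (σ 1 + η⁻¹ • w) (-η⁻¹)
    simpa using this
  exact (s1.trans hf s2).trans hf s3

lemma freeDir_rule (hf : ContDiff ℝ 1 f) (hB : ∀ x y, B x y = B y x)
    (hfB : ∀ x, f x = B x x + A x) {w v : X} (hw : w ∈ freeDir hf U) (hv : v ∈ freeDir hf U)
    (hww : B w w = 0) : B w v ∈ freeDir hf U := by
  have key : ∀ v' ∈ freeDir hf U, ∀ (x : X) (t : ℝ), 0 < t → ClR f U x (x + t • B w v') := by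
    intro v' hv' x t ht
    have hn : ∀ n : ℕ, ClR f U x
        (x + (t / 2 / ((n : ℝ) + 1)) • B (((n : ℝ) + 1) • w + v') (((n : ℝ) + 1) • w + v')) := by
      intro n
      apply clR_quad hf hB hfB
      · exact Submodule.add_mem _ (Submodule.smul_mem _ _ hw) hv'
      · positivity
    apply clR_of_tendsto hn
    have e : ∀ n : ℕ, x + (t / 2 / ((n : ℝ) + 1)) •
        B (((n : ℝ) + 1) • w + v') (((n : ℝ) + 1) • w + v') =
        x + t • B w v' + (1 / ((n : ℝ) + 1)) • ((t / 2) • B v' v') := by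
      intro n
      have hn0 : (n : ℝ) + 1 ≠ 0 := by positivity
      simp only [map_add, map_smul, LinearMap.add_apply, LinearMap.smul_apply, hB v' w, hww,
        smul_zero, zero_add, smul_add, smul_smul]
      have e1 : t / 2 / ((n : ℝ) + 1) * ((n : ℝ) + 1) = t / 2 := by field_simp
      have e2 : t / 2 / ((n : ℝ) + 1) = 1 / ((n : ℝ) + 1) * (t / 2) := by field_simp
      rw [e1, e2]
      module
    simp only [e]
    have := (tendsto_one_div_add_atTop_nhds_zero_nat (𝕜 := ℝ)).smul_const ((t / 2) • B v' v')
    simpa using this.const_add (x + t • B w v')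
  intro x t
  rcases lt_trichotomy t 0 with h | h | h
  · have := key (-v) (Submodule.neg_mem _ hv) x (-t) (by linarith)
    simpa using this
  · subst h; simpa using ClR.refl x
  · exact key v hv x t h

end Density

end MRB

namespace MRB

open Filter Topology

section Exact

variable {V : Type} [NormedAddCommGroup V] [NormedSpace ℝ V] [FiniteDimensional ℝ V]

/-- short time existence -/
lemma exists_short {X : Type*} [NormedAddCommGroup X] [NormedSpace ℝ X] [FiniteDimensional ℝ X]
    {F : X → X} (hF : ContDiff ℝ 1 F) (x : X) :
    ∃ τ : ℝ, 0 < τ ∧ ∃ γ, Sol (fun z => τ • F z) γ ∧ γ 0 = x := by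
  have hG : ContDiff ℝ 1 (fun p : X × ℝ => p.2 • F p.1) := by fun_prop
  have h0 : Sol (fun z => (fun p : X × ℝ => p.2 • F p.1) (z, (0 : ℝ))) (fun _ => x) := by
    intro t _
    simpa using hasDerivWithinAt_const t (Icc (0 : ℝ) 1) x
  have hev := flow_param hG h0 (N := univ) univ_mem
  have hc : Tendsto (fun η : ℝ => (x, η)) (𝓝 0) (𝓝 (x, 0)) := by
    have : Continuous (fun η : ℝ => (x, η)) := by fun_prop
    simpa using this.tendsto 0
  obtain ⟨η, hη, σ, hσ, h0, -⟩ := exists_small (hc hev)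
  exact ⟨η, hη, σ, hσ, h0⟩

/-- rescaling of time -/
lemma Sol.rescale {X : Type*} [NormedAddCommGroup X] [NormedSpace ℝ X]
    {F : X → X} {γ : ℝ → X} {τ : ℝ} (h : Sol (fun z => τ • F z) γ) {s : ℝ} (hs : s ∈ Icc (0 : ℝ) 1) :
    Sol (fun z => (s * τ) • F z) (fun t => γ (s * t)) := by
  intro t ht
  have hmem : ∀ r ∈ Icc (0 : ℝ) 1, s * r ∈ Icc (0 : ℝ) 1 := fun r hr =>
    ⟨mul_nonneg hs.1 hr.1, mul_le_one₀ hs.2 hr.1 hr.2⟩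
  have h1 := h (s * t) (hmem t ht)
  have h2 : HasDerivWithinAt (fun r : ℝ => s * r) s (Icc 0 1) t := by
    simpa using (hasDerivWithinAt_id t (Icc (0 : ℝ) 1)).const_mul s
  have := h1.scomp t h2 hmem
  rw [smul_smul] at this
  exact this

/-- The quadratic drift. -/
noncomputable def fq (B : V →L[ℝ] V →L[ℝ] V) (a : ℝ) : V → V := fun x => B x x + a • x

/-- The cotangent lift of the drift. -/
noncomputable def fhat (B : V →L[ℝ] V →L[ℝ] V) (a : ℝ) : V × (V →L[ℝ] ℝ) → V × (V →L[ℝ] ℝ) :=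
  fun z => (B z.1 z.1 + a • z.1, -((2 : ℝ) • z.2.comp (B z.1) + a • z.2))

/-- The bilinear part of the lift. -/
noncomputable def Bhat (B : V →L[ℝ] V →L[ℝ] V) :
    V × (V →L[ℝ] ℝ) →ₗ[ℝ] V × (V →L[ℝ] ℝ) →ₗ[ℝ] V × (V →L[ℝ] ℝ) :=
  LinearMap.mk₂ ℝ (fun z z' => (B z.1 z'.1, -(z.2.comp (B z'.1) + z'.2.comp (B z.1))))
    (by
      intro x y z
      ext v <;> simp
      ring)
    (by
      intro c x y
      ext v <;> simp)
    (by
      intro x y z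
      ext v <;> simp
      ring)
    (by
      intro c x y
      ext v <;> simp)

/-- The linear part of the lift. -/
noncomputable def Ahat (a : ℝ) : V × (V →L[ℝ] ℝ) →ₗ[ℝ] V × (V →L[ℝ] ℝ) :=
  LinearMap.prodMap (a • LinearMap.id) ((-a) • LinearMap.id)

variable {B : V →L[ℝ] V →L[ℝ] V} {a : ℝ} {U : Submodule ℝ V}

lemma contDiff_fq : ContDiff ℝ 1 (fq B a) := by
  unfold fq; fun_prop

lemma contDiff_fhat : ContDiff ℝ 1 (fhat B a) := by
  unfold fhat
  have h : ContDiff ℝ 1 (fun z : V × (V →L[ℝ] ℝ) => z.2.comp (B z.1)) :=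
    contDiff_snd.clm_comp (B.contDiff.comp contDiff_fst)
  fun_prop

lemma fhat_eq (z : V × (V →L[ℝ] ℝ)) : fhat B a z = Bhat B z z + Ahat a z := by
  ext v
  · simp [fhat, Bhat, Ahat]
  · simp [fhat, Bhat, Ahat]
    ring

lemma Bhat_symm (hB : ∀ x y, B x y = B y x) (z z' : V × (V →L[ℝ] ℝ)) :
    Bhat B z z' = Bhat B z' z := by
  ext v
  · simp [Bhat, hB z.1 z'.1]
  · simp [Bhat]
    ring

/-- generation condition -/
def Gen (B : V →L[ℝ] V →L[ℝ] V) (U : Submodule ℝ V) : Prop :=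
  ∀ S : Submodule ℝ V, U ≤ S → (∀ w ∈ S, ∀ v ∈ S, B w w = 0 → B w v ∈ S) → S = ⊤

lemma clR_all (hB : ∀ x y, B x y = B y x) (hgen : Gen B U) (x y : V) : ClR (fq B a) U x y := by
  have hf : ContDiff ℝ 1 (fq B a) := contDiff_fq
  let B' : V →ₗ[ℝ] V →ₗ[ℝ] V := ContinuousLinearMap.toLinearMap₁₂ B
  have hS := hgen (freeDir hf U) (le_freeDir hf) (by
    intro w hw v hv hww
    exact freeDir_rule (B := B') (A := a • LinearMap.id) hf hB (fun x => rfl) hw hv hww)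
  have h1 : y - x ∈ freeDir hf U := by rw [hS]; trivial
  have := h1 x 1
  simpa using this

lemma clR_hat (hB : ∀ x y, B x y = B y x) (hgen : Gen B U) (x y : V) (p : V →L[ℝ] ℝ) :
    ClR (fhat B a) (U.prod ⊥) (x, p) (y, p) := by
  have hf : ContDiff ℝ 1 (fhat B a) := contDiff_fhat
  have hS := hgen ((freeDir hf (U.prod ⊥)).comap (LinearMap.inl ℝ V (V →L[ℝ] ℝ)))
    (by
      intro u hu
      exact le_freeDir hf (by simpa [Submodule.mem_prod] using hu))
    (by
      intro w hw v hv hww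
      have h1 : Bhat B (w, 0) (w, 0) = 0 := by
        ext v <;> simp [Bhat, hww]
      have h2 : Bhat B (w, 0) (v, 0) = (B w v, 0) := by
        ext v <;> simp [Bhat]
      have := freeDir_rule hf (Bhat_symm hB) fhat_eq hw hv h1
      change (B w v, (0 : V →L[ℝ] ℝ)) ∈ freeDir hf (U.prod ⊥)
      rw [← h2]
      exact this)
  have h1 : y - x ∈ (freeDir hf (U.prod ⊥)).comap (LinearMap.inl ℝ V (V →L[ℝ] ℝ)) := by
    rw [hS]; trivial
  have := h1 (x, p) 1
  simpa using this

/-- `R` is the image of the derivative of a parametrised family of points reachable from `z`. -/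
def Good (f : V → V) (U : Submodule ℝ V) (z y : V) (R : Submodule ℝ V) : Prop :=
  ∃ (P : Type) (_ : NormedAddCommGroup P) (_ : NormedSpace ℝ P) (_ : FiniteDimensional ℝ P)
    (E : P → V) (E' : P →L[ℝ] V) (b : P), HasStrictFDerivAt E E' b ∧ E b = y ∧
    LinearMap.range (E' : P →ₗ[ℝ] V) = R ∧ ∀ᶠ b' in 𝓝 b, Reach f U z (E b')

lemma good_refl {f : V → V} (z : V) : Good f U z z ⊥ :=
  ⟨ℝ, inferInstance, inferInstance, inferInstance, fun _ => z, 0, 0, hasStrictFDerivAt_const _ _,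
    rfl, by ext; simp, Eventually.of_forall fun _ => Relation.ReflTransGen.refl⟩

lemma good_interior {f : V → V} {z y : V} (h : Good f U z y ⊤) :
    ∀ᶠ y' in 𝓝 y, Reach f U z y' := by
  obtain ⟨P, _, _, _, E, E', b, hE, rfl, hR, hev⟩ := h
  have : CompleteSpace P := FiniteDimensional.complete ℝ P
  have : CompleteSpace V := FiniteDimensional.complete ℝ V
  rw [← hE.map_nhds_eq_of_surj hR]
  exact hev

lemma good_step {f : V → V} (hf : ContDiff ℝ 1 f) {z : V} {R : Submodule ℝ V} {τ : ℝ} (hτ : 0 < τ)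
    {u : V} (hu : u ∈ U) {γ : ℝ → V} (hγ : Sol (fun x => τ • (f x + u)) γ)
    (hg : Good f U z (γ 0) R) :
    ∃ N : ℝ → (V × U →L[ℝ] V), N 0 = ContinuousLinearMap.fst ℝ V U ∧
      (∀ t ∈ Icc (0 : ℝ) 1, HasDerivWithinAt N (τ • ((fderiv ℝ f (γ t)).comp (N t) +
        U.subtypeL.comp (ContinuousLinearMap.snd ℝ V U))) (Icc 0 1) t) ∧
      (∀ ξ, N 1 (ξ, 0) = 0 → ξ = 0) ∧
      Good f U z (γ 1) ((R.prod ⊤).map (N 1 : V × U →ₗ[ℝ] V)) := by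
  have hG : ContDiff ℝ 1 (fun p : V × U => τ • (f p.1 + (p.2 : V))) := by
    have : ContDiff ℝ 1 (fun p : V × U => (p.2 : V)) := U.subtypeL.contDiff.comp contDiff_snd
    fun_prop
  have hF : ContDiff ℝ 1 (fun p : V × U => (τ • (f p.1 + (p.2 : V)), (0 : U))) :=
    hG.prodMk contDiff_const
  have hs : Sol (fun z => (fun p : V × U => τ • (f p.1 + (p.2 : V))) (z, (⟨u, hu⟩ : U))) γ := hγ
  obtain ⟨Φ, M, hM0, hM, hinj, hΦ, hΦ1, hev⟩ := flow_diff hF (sol_param_mk hs)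
  have hfd : ∀ p : V × U, fderiv ℝ (fun p : V × U => (τ • (f p.1 + (p.2 : V)), (0 : U))) p =
      (τ • ((fderiv ℝ f p.1).comp (ContinuousLinearMap.fst ℝ V U) +
        U.subtypeL.comp (ContinuousLinearMap.snd ℝ V U))).prod 0 := by
    intro p
    apply HasFDerivAt.fderiv
    have h1 : HasFDerivAt f (fderiv ℝ f p.1) p.1 := (hf.differentiable one_ne_zero _).hasFDerivAt
    have h2 := h1.comp p (hasFDerivAt_fst (𝕜 := ℝ) (E := V) (F := U) (p := p))
    have h3 := (U.subtypeL.hasFDerivAt (x := p.2)).comp p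
      (hasFDerivAt_snd (𝕜 := ℝ) (E := V) (F := U) (p := p))
    exact ((h2.add h3).const_smul τ).prodMk (hasFDerivAt_const _ _)
  have hsnd : ∀ (p : V × U), ∀ t ∈ Icc (0 : ℝ) 1, (M t p).2 = p.2 := by
    intro p
    have hd : ∀ t ∈ Icc (0 : ℝ) 1, HasDerivWithinAt (fun t => (M t p).2) 0 (Icc 0 1) t := by
      intro t ht
      have h1 := ((hM t ht).clm_apply (hasDerivWithinAt_const t (Icc (0 : ℝ) 1) p)).snd
      refine HasDerivWithinAt.congr_deriv h1 ?_
      rw [hfd]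
      simp
    have h2 := constant_of_has_deriv_right_zero (fun t ht => (hd t ht).continuousWithinAt)
      (fun t ht => derivIci ht (hd t ⟨ht.1, ht.2.le⟩))
    intro t ht
    rw [h2 t ht, hM0]
    rfl
  refine ⟨fun t => (ContinuousLinearMap.fst ℝ V U).comp (M t), ?_, ?_, ?_, ?_⟩
  · change (ContinuousLinearMap.fst ℝ V U).comp (M 0) = _
    rw [hM0]; rfl
  · intro t ht
    have := (ContinuousLinearMap.compL ℝ (V × U) (V × U) V
        (ContinuousLinearMap.fst ℝ V U)).hasFDerivAt.comp_hasDerivWithinAt t (hM t ht)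
    refine HasDerivWithinAt.congr_deriv (f := fun t =>
        (ContinuousLinearMap.fst ℝ V U).comp (M t)) this ?_
    rw [hfd]
    apply ContinuousLinearMap.ext
    intro p
    have h3 : (M t p).2 = p.2 := hsnd p t ht
    simp [h3]
  · intro ξ hξ
    have h3 : (M 1 (ξ, 0)).2 = 0 := hsnd (ξ, 0) 1 (by simp)
    have h4 : M 1 (ξ, 0) = 0 := Prod.ext hξ h3
    have h5 : ((ξ, 0) : V × U) = 0 := hinj (by rw [h4, map_zero])
    exact congrArg Prod.fst h5
  · obtain ⟨P, _, _, _, E, E', b, hE, hEb, hR, hevE⟩ := hg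
    have hΨ : HasStrictFDerivAt (fun q : P × U => (E q.1, q.2))
        ((E'.comp (ContinuousLinearMap.fst ℝ P U)).prod (ContinuousLinearMap.snd ℝ P U))
        (b, ⟨u, hu⟩) :=
      (hE.comp (b, (⟨u, hu⟩ : U)) hasStrictFDerivAt_fst).prodMk hasStrictFDerivAt_snd
    have hΦ' : HasStrictFDerivAt Φ (M 1) ((fun q : P × U => (E q.1, q.2)) (b, ⟨u, hu⟩)) := by
      simp only [hEb]; exact hΦ
    refine ⟨P × U, inferInstance, inferInstance, inferInstance,
      fun q => (Φ (E q.1, q.2)).1, (ContinuousLinearMap.fst ℝ V U).comp ((M 1).comp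
        ((E'.comp (ContinuousLinearMap.fst ℝ P U)).prod (ContinuousLinearMap.snd ℝ P U))),
      (b, ⟨u, hu⟩), ?_, ?_, ?_, ?_⟩
    · have h6 := HasStrictFDerivAt.comp (g := Φ) (f := fun q : P × U => (E q.1, q.2))
        (b, (⟨u, hu⟩ : U)) hΦ' hΨ
      exact hasStrictFDerivAt_fst.comp (b, (⟨u, hu⟩ : U)) h6
    · simp only [hEb, hΦ1]
    · rw [← hR]
      ext v
      constructor
      · rintro ⟨⟨q, μ⟩, rfl⟩
        exact ⟨(E' q, μ), ⟨⟨q, rfl⟩, trivial⟩, rfl⟩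
      · rintro ⟨⟨w, μ⟩, ⟨⟨q, rfl⟩, -⟩, rfl⟩
        exact ⟨(q, μ), rfl⟩
    · have hc : Tendsto (fun q : P × U => (E q.1, q.2)) (𝓝 (b, ⟨u, hu⟩)) (𝓝 (γ 0, ⟨u, hu⟩)) := by
        have := hΨ.continuousAt
        rw [ContinuousAt] at this
        simpa only [hEb] using this
      have hfst : Tendsto (Prod.fst : P × U → P) (𝓝 (b, ⟨u, hu⟩)) (𝓝 b) :=
        continuous_fst.continuousAt
      filter_upwards [hc.eventually hev, hfst.eventually hevE] with q ⟨σ, hσ, h0, h1⟩ hq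
      refine Relation.ReflTransGen.tail hq ⟨τ, hτ, q.2, q.2.2, fun t => (σ t).1, ?_, ?_, ?_⟩
      · have := sol_param hσ
        rw [h0] at this
        exact this
      · exact congrArg Prod.fst h0
      · exact congrArg Prod.fst h1

end Exact

end MRB

namespace MRB

open Filter Topology

section Exact2

variable {V : Type} [NormedAddCommGroup V] [NormedSpace ℝ V] [FiniteDimensional ℝ V]
variable {B : V →L[ℝ] V →L[ℝ] V} {a : ℝ} {U : Submodule ℝ V}

lemma hasFDerivAt_fq (hB : ∀ x y, B x y = B y x) (x : V) :
    HasFDerivAt (fq B a) ((2 : ℝ) • B x + a • ContinuousLinearMap.id ℝ V) x := by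
  have h1 : HasFDerivAt (fun y => B y y) ((B x).comp (ContinuousLinearMap.id ℝ V) + B.flip x) x := by
    have := (B.hasFDerivAt (x := x)).clm_apply (hasFDerivAt_id x)
    exact this
  have h2 := h1.add ((hasFDerivAt_id (𝕜 := ℝ) x).const_smul a)
  refine HasFDerivAt.congr_fderiv h2 ?_
  ext v
  simp [hB v x]
  module

lemma sol_hat_fst {τ : ℝ} {u : V} {γ : ℝ → V × (V →L[ℝ] ℝ)}
    (h : Sol (fun z => τ • (fhat B a z + (u, 0))) γ) :
    Sol (fun x => τ • (fq B a x + u)) (fun t => (γ t).1) :=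
  fun t ht => (h t ht).fst

lemma sol_hat_snd {τ : ℝ} {u : V} {γ : ℝ → V × (V →L[ℝ] ℝ)}
    (h : Sol (fun z => τ • (fhat B a z + (u, 0))) γ) :
    ∀ t ∈ Icc (0 : ℝ) 1, HasDerivWithinAt (fun t => (γ t).2)
      (-(τ • ((2 : ℝ) • (γ t).2.comp (B (γ t).1) + a • (γ t).2))) (Icc 0 1) t := by
  intro t ht
  refine HasDerivWithinAt.congr_deriv (h t ht).snd ?_
  simp [fhat]

lemma good_hat (hB : ∀ x y, B x y = B y x) {z : V} {R : Submodule ℝ V} {τ : ℝ} (hτ : 0 < τ)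
    {u : V} (hu : u ∈ U) {γ : ℝ → V × (V →L[ℝ] ℝ)}
    (hγ : Sol (fun z => τ • (fhat B a z + (u, 0))) γ)
    (hg : Good (fq B a) U z (γ 0).1 R) (hp : ∀ ξ ∈ R, (γ 0).2 ξ = 0)
    (hmax : ∀ y R', Good (fq B a) U z y R' → Module.finrank ℝ R' ≤ Module.finrank ℝ R) :
    (∃ R', Good (fq B a) U z (γ 1).1 R' ∧ Module.finrank ℝ R' = Module.finrank ℝ R ∧
      ∀ ξ ∈ R', (γ 1).2 ξ = 0) ∧
    ∀ μ ∈ U, ∃ c ∈ Ioo (0 : ℝ) 1, (γ c).2 μ = 0 := by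
  obtain ⟨N, hN0, hN, hinj, hgood⟩ := good_step (contDiff_fq (B := B) (a := a)) hτ hu
    (sol_hat_fst hγ) hg
  have hd : ∀ (p : V × U), ∀ t ∈ Icc (0 : ℝ) 1,
      HasDerivWithinAt (fun t => (γ t).2 (N t p)) (τ * (γ t).2 (p.2 : V)) (Icc 0 1) t := by
    intro p t ht
    have h1 := (hN t ht).clm_apply (hasDerivWithinAt_const t (Icc (0 : ℝ) 1) p)
    have h2 := (sol_hat_snd hγ t ht).clm_apply h1
    refine HasDerivWithinAt.congr_deriv h2 ?_
    rw [(hasFDerivAt_fq hB _).fderiv]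
    simp
    ring
  have hc : ∀ p, ContinuousOn (fun t => (γ t).2 (N t p)) (Icc 0 1) :=
    fun p t ht => (hd p t ht).continuousWithinAt
  have hN0' : ∀ p, N 0 p = p.1 := by intro p; rw [hN0]; rfl
  set L : V →ₗ[ℝ] V := (N 1 : V × U →ₗ[ℝ] V).comp (LinearMap.inl ℝ V U) with hL
  have hLinj : Function.Injective L := by
    rw [← LinearMap.ker_eq_bot, LinearMap.ker_eq_bot']
    exact fun ξ hξ => hinj ξ hξ
  have hle : R.map L ≤ (R.prod ⊤).map (N 1 : V × U →ₗ[ℝ] V) := by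
    rintro _ ⟨ξ, hξ, rfl⟩
    exact ⟨(ξ, 0), ⟨hξ, trivial⟩, rfl⟩
  have hfr : Module.finrank ℝ (R.map L) = Module.finrank ℝ R :=
    (LinearEquiv.finrank_eq (Submodule.equivMapOfInjective L hLinj R)).symm
  have heq : R.map L = (R.prod ⊤).map (N 1 : V × U →ₗ[ℝ] V) :=
    Submodule.eq_of_le_of_finrank_le hle (by rw [hfr]; exact hmax _ _ hgood)
  have hperp : ∀ ξ ∈ R.map L, (γ 1).2 ξ = 0 := by
    rintro _ ⟨ξ, hξ, rfl⟩
    have h2 := constant_of_has_deriv_right_zero (hc (ξ, 0))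
      (fun t ht => derivIci ht (by simpa using hd (ξ, 0) t ⟨ht.1, ht.2.le⟩)) 1 (by simp)
    rw [hN0', hp ξ hξ] at h2
    exact h2
  refine ⟨⟨_, hgood, by rw [← heq, hfr], by rw [← heq]; exact hperp⟩, ?_⟩
  intro μ hμ
  have h1 : (γ 1).2 (N 1 (0, ⟨μ, hμ⟩)) = 0 :=
    hperp _ (by rw [heq]; exact ⟨(0, ⟨μ, hμ⟩), ⟨R.zero_mem, trivial⟩, rfl⟩)
  have h0 : (γ 0).2 (N 0 (0, ⟨μ, hμ⟩)) = 0 := by rw [hN0']; simp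
  obtain ⟨c, hcm, hc0⟩ := exists_hasDerivAt_eq_zero (f := fun t => (γ t).2 (N t (0, ⟨μ, hμ⟩)))
    (f' := fun t => τ * (γ t).2 μ) zero_lt_one (hc _) (by rw [h0, h1])
    (fun t ht => (hd (0, ⟨μ, hμ⟩) t ⟨ht.1.le, ht.2.le⟩).hasDerivAt (Icc_mem_nhds ht.1 ht.2))
  exact ⟨c, hcm, (mul_eq_zero.1 hc0).resolve_left hτ.ne'⟩

lemma exists_short_hat (x : V × (V →L[ℝ] ℝ)) :
    ∃ τ : ℝ, 0 < τ ∧ ∃ γ, (Sol (fun z => τ • (fhat B a z + ((0 : V), (0 : V →L[ℝ] ℝ)))) γ ∧ γ 0 = x) := by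
  obtain ⟨τ, hτ, γ, h, h0⟩ := exists_short (contDiff_fhat (B := B) (a := a)) x
  refine ⟨τ, hτ, γ, ?_, h0⟩
  have e : (fun z => τ • (fhat B a z + ((0 : V), (0 : V →L[ℝ] ℝ)))) = fun z => τ • fhat B a z := by
    funext z
    rw [Prod.mk_zero_zero, add_zero]
  rw [e]
  exact h

theorem interior_nonempty (hB : ∀ x y, B x y = B y x) (hgen : Gen B U) (z : V) :
    ∃ y, ∀ᶠ y' in 𝓝 y, Reach (fq B a) U z y' := by
  obtain ⟨y0, R0, hg0, hmax⟩ : ∃ y R, Good (fq B a) U z y R ∧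
      ∀ y' R', Good (fq B a) U z y' R' → Module.finrank ℝ R' ≤ Module.finrank ℝ R := by
    let T : Set ℕ := {r | ∃ y R, Good (fq B a) U z y R ∧ Module.finrank ℝ R = r}
    have hne : T.Nonempty := ⟨_, z, ⊥, good_refl z, rfl⟩
    have hb : BddAbove T := by
      refine ⟨Module.finrank ℝ V, ?_⟩
      rintro _ ⟨y, R, -, rfl⟩
      exact Submodule.finrank_le R
    obtain ⟨y, R, hg, hr⟩ := Nat.sSup_mem hne hb
    refine ⟨y, R, hg, fun y' R' hg' => ?_⟩
    rw [hr]
    exact le_csSup hb ⟨y', R', hg', rfl⟩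
  by_cases hR : R0 = ⊤
  · subst hR
    exact ⟨y0, good_interior hg0⟩
  exfalso
  obtain ⟨p', hp'0, hp'⟩ := Submodule.exists_le_ker_of_lt_top R0 (lt_top_iff_ne_top.2 hR)
  set p0 : V →L[ℝ] ℝ := LinearMap.toContinuousLinearMap p' with hp0
  have hp0R : ∀ ξ ∈ R0, p0 ξ = 0 := fun ξ hξ => hp' hξ
  let J : V × (V →L[ℝ] ℝ) → Prop := fun w => ∃ R, Good (fq B a) U z w.1 R ∧
    Module.finrank ℝ R = Module.finrank ℝ R0 ∧ ∀ ξ ∈ R, w.2 ξ = 0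
  have hJstep : ∀ w w', J w → Step (fhat B a) (U.prod ⊥) w w' → J w' := by
    rintro w w' ⟨R, hg, hr, hp⟩ ⟨τ, hτ, u, hu, γ, hγ, rfl, rfl⟩
    obtain ⟨u, q⟩ := u
    obtain ⟨hu, hq⟩ := hu
    simp only [Submodule.bot_coe, SetLike.mem_coe, mem_singleton_iff] at hq hu
    subst hq
    obtain ⟨⟨R', h1, h2, h3⟩, -⟩ := good_hat hB hτ hu hγ hg hp (by rw [hr]; exact hmax)
    exact ⟨R', h1, h2.trans hr, h3⟩
  have hJreach : ∀ w, Reach (fhat B a) (U.prod ⊥) (y0, p0) w → J w := by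
    intro w hw
    induction hw with
    | refl => exact ⟨R0, hg0, rfl, hp0R⟩
    | tail _ hs ih => exact hJstep _ _ ih hs
  have hJU : ∀ w, J w → ∀ μ ∈ U, w.2 μ = 0 := by
    rintro w ⟨R, hg, hr, hp⟩ μ hμ
    obtain ⟨τ, hτ, γ, hγ, rfl⟩ := exists_short_hat (B := B) (a := a) w
    by_contra hne
    have hcont : ContinuousWithinAt (fun t => (γ t).2 μ) (Icc 0 1) 0 := by
      have := (sol_hat_snd hγ 0 (by simp)).continuousWithinAt
      exact this.clm_apply continuousWithinAt_const
    have hev : ∀ᶠ t in 𝓝[Icc 0 1] (0 : ℝ), (γ t).2 μ ≠ 0 := hcont.eventually_ne hne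
    have hev' : ∀ᶠ t in 𝓝[≥] (0 : ℝ), (γ t).2 μ ≠ 0 := by
      rwa [nhdsWithin_Icc_eq_nhdsGE zero_lt_one] at hev
    obtain ⟨s, hs, hsub⟩ := mem_nhdsGE_iff_exists_Ico_subset.1 hev'
    have hs0 : (0 : ℝ) < s := hs
    have hs' : min s 1 ∈ Icc (0 : ℝ) 1 := ⟨by positivity, min_le_right _ _⟩
    have hsp : 0 < min s 1 := by positivity
    have hγ' := hγ.rescale hs'
    obtain ⟨-, h2⟩ := good_hat (z := z) (R := R) hB (mul_pos hsp hτ) U.zero_mem hγ'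
      (by simpa using hg) (by simpa using hp) (by rw [hr]; exact hmax)
    obtain ⟨c, hc, hc0⟩ := h2 μ hμ
    refine hsub (a := min s 1 * c) ⟨mul_nonneg hsp.le hc.1.le, ?_⟩ hc0
    calc min s 1 * c < min s 1 * 1 := by gcongr; exact hc.2
      _ ≤ s := by rw [mul_one]; exact min_le_left _ _
  -- the closure
  let K : V × (V →L[ℝ] ℝ) → Prop := ClR (fhat B a) (U.prod ⊥) (y0, p0)
  have hfh : ContDiff ℝ 1 (fhat B a) := contDiff_fhat
  have hKU : ∀ w, K w → ∀ μ ∈ U, w.2 μ = 0 := by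
    intro w hw μ hμ
    have hcl : IsClosed {w : V × (V →L[ℝ] ℝ) | w.2 μ = 0} :=
      isClosed_eq (by fun_prop) continuous_const
    exact closure_minimal (fun w hw => hJU w (hJreach w hw) μ hμ) hcl hw
  have hKx : ∀ x x' q, K (x, q) → K (x', q) := fun x x' q h =>
    ClR.trans hfh h (clR_hat hB hgen x x' q)
  let I : Submodule ℝ V :=
    { carrier := {v | ∀ w, K w → w.2 v = 0}
      zero_mem' := by intro w _; simp
      add_mem' := by
        intro v v' hv hv' w hw
        rw [map_add, hv w hw, hv' w hw, add_zero]
      smul_mem' := by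
        intro c v hv w hw
        rw [map_smul, hv w hw, smul_zero] }
  have hI : I = ⊤ := by
    apply hgen I
    · exact fun μ hμ w hw => hKU w hw μ hμ
    · intro y _ v hv _ w hw
      have hw' : K (y, w.2) := hKx w.1 y w.2 hw
      obtain ⟨τ, hτ, γ, hγ, hγ0⟩ := exists_short_hat (B := B) (a := a) (y, w.2)
      have hKt : ∀ t ∈ Icc (0 : ℝ) 1, K (γ t) := by
        intro t ht
        rcases ht.1.eq_or_lt with h | h
        · rw [← h, hγ0]; exact hw'
        · refine ClR.trans hfh hw' (Step.clR ⟨t * τ, mul_pos h hτ, 0, Submodule.zero_mem _, _,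
            hγ.rescale ht, ?_, ?_⟩)
          · simp [hγ0]
          · simp
      have hd := (sol_hat_snd hγ 0 (by simp)).clm_apply (hasDerivWithinAt_const 0 (Icc (0 : ℝ) 1) v)
      have hd0 : HasDerivWithinAt (fun t => (γ t).2 v) 0 (Icc 0 1) 0 :=
        (hasDerivWithinAt_const (0 : ℝ) (Icc (0 : ℝ) 1) (0 : ℝ)).congr
          (fun t ht => hv _ (hKt t ht)) (hv _ (hKt 0 (by simp)))
      have huniq := (uniqueDiffOn_Icc_zero_one (0 : ℝ) (by simp)).eq_deriv _ hd hd0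
      have hv0 : w.2 v = 0 := hv _ hw
      rw [hγ0] at huniq
      simp [hv0, hτ.ne'] at huniq
      exact huniq
  apply hp'0
  ext v
  have : v ∈ I := by rw [hI]; trivial
  exact this (y0, p0) (ClR.refl _)

lemma Step.reverse {x y : V} (h : Step (fq (-B) (-a)) U x y) : Step (fq B a) U y x := by
  obtain ⟨τ, hτ, u, hu, γ, hγ, rfl, rfl⟩ := h
  refine ⟨τ, hτ, -u, U.neg_mem hu, fun t => γ (1 - t), ?_, by simp, by simp⟩
  intro t ht
  have hmem : ∀ r ∈ Icc (0 : ℝ) 1, 1 - r ∈ Icc (0 : ℝ) 1 := fun r hr =>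
    ⟨by linarith [hr.2], by linarith [hr.1]⟩
  have h1 := hγ (1 - t) (hmem t ht)
  have h2 : HasDerivWithinAt (fun r : ℝ => 1 - r) (-1) (Icc 0 1) t := by
    simpa using (hasDerivWithinAt_id t (Icc (0 : ℝ) 1)).const_sub 1
  have := h1.scomp t h2 hmem
  refine HasDerivWithinAt.congr_deriv this ?_
  simp [fq]

lemma Reach.reverse {x y : V} (h : Reach (fq (-B) (-a)) U x y) : Reach (fq B a) U y x := by
  induction h with
  | refl => exact Relation.ReflTransGen.refl
  | tail _ hs ih => exact Relation.ReflTransGen.head hs.reverse ih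

theorem reach_all (hB : ∀ x y, B x y = B y x) (hgen : Gen B U) (x y : V) :
    Reach (fq B a) U x y := by
  obtain ⟨y0, hy0⟩ := interior_nonempty (B := -B) (a := -a) (U := U) (by simpa using hB)
    (by
      intro S h1 h2
      refine hgen S h1 (fun w hw v hv hww => ?_)
      have := h2 w hw v hv (by simp [hww])
      simpa using this) y
  obtain ⟨z, hz, hr⟩ := mem_closure_iff_nhds.1 (clR_all (a := a) hB hgen x y0) _ hy0
  exact Relation.ReflTransGen.trans hr (Reach.reverse hz)

end Exact2

end MRB

namespace MRB

open Filter Topology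

section Append

variable {n m : ℕ} {C : Mat n} {ν : ℝ} {G : Fin m → Mat n}

lemma steers_refl {Ω₀ : Mat n} (h : IsSkew Ω₀) : Steers C ν G Ω₀ Ω₀ :=
  ⟨0, fun _ _ => 0, fun _ => Ω₀, 0, fun _ => 0, le_rfl, rfl, rfl, by simp, continuousOn_const,
    fun _ _ => h, rfl, rfl, by simp, by simp⟩

lemma steers_append {Ω₀ Ω₁ : Mat n} (h : Steers C ν G Ω₀ Ω₁) {τ : ℝ} (hτ : 0 < τ) (κ : Fin m → ℝ)
    {ω : ℝ → Mat n} (hω : ContinuousOn ω (Icc 0 τ)) (hsk : ∀ s ∈ Icc (0 : ℝ) τ, IsSkew (ω s))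
    (h0 : ω 0 = Ω₁)
    (hD : ∀ s ∈ Ioo (0 : ℝ) τ, ∃ D : Mat n,
      (∀ p q : Fin n, HasDerivAt (fun τ => ω τ p q) (D p q) s) ∧
      IC C D = mbracket C ((ω s) ^ 2) - ν • IC C (ω s) + ∑ j, κ j • IC C (G j)) :
    Steers C ν G Ω₀ (ω τ) := by
  obtain ⟨T, u, Ω, k, t, hT, ht0, htk, hmono, hc, hs, hΩ0, hΩT, hu, hder⟩ := h
  have hle : ∀ d i, i + d = k → t i ≤ T := by
    intro d
    induction d with
    | zero => intro i hi; rw [← htk, ← hi]; simp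
    | succ d ih =>
      intro i hi
      exact (hmono i (by omega)).le.trans (ih (i + 1) (by omega))
  have hle' : ∀ i, i ≤ k → t i ≤ T := fun i hi => hle (k - i) i (by omega)
  set Ω' : ℝ → Mat n := fun s => if s ≤ T then Ω s else ω (s - T) with hΩ'
  set u' : Fin m → ℝ → ℝ := fun j s => if s ≤ T then u j s else κ j with hu'
  set t' : ℕ → ℝ := fun i => if i ≤ k then t i else T + τ with ht'
  have e1 : ∀ s, s ≤ T → Ω' s = Ω s := fun s hs => if_pos hs
  have e2 : ∀ s, T ≤ s → Ω' s = ω (s - T) := by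
    intro s hs
    rcases hs.eq_or_lt with h | h
    · rw [← h, e1 T le_rfl, sub_self, h0, hΩT]
    · exact if_neg (not_le.2 h)
  have ta : ∀ i, i ≤ k → t' i = t i := fun i hi => if_pos hi
  have tb : t' (k + 1) = T + τ := if_neg (by omega)
  refine ⟨T + τ, u', Ω', k + 1, t', by linarith, by rw [ta 0 (by omega), ht0], tb, ?_, ?_, ?_, ?_,
    ?_, ?_, ?_⟩
  · intro i hi
    rcases Nat.lt_succ_iff_lt_or_eq.1 hi with h | h
    · rw [ta i (by omega), ta (i + 1) (by omega)]; exact hmono i h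
    · subst h; rw [ta i le_rfl, tb, htk]; linarith
  · have c1 : ContinuousOn Ω' (Icc 0 T) := hc.congr (fun s hs => e1 s hs.2)
    have c2 : ContinuousOn Ω' (Icc T (T + τ)) := by
      have : ContinuousOn (fun s => ω (s - T)) (Icc T (T + τ)) :=
        hω.comp (by fun_prop) (fun s hs => ⟨by linarith [hs.1], by linarith [hs.2]⟩)
      exact this.congr (fun s hs => e2 s hs.1)
    have := c1.union_of_isClosed c2 isClosed_Icc isClosed_Icc
    rwa [Icc_union_Icc_eq_Icc hT (by linarith)] at this
  · intro s hss
    rcases le_total s T with h | h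
    · rw [e1 s h]; exact hs s ⟨hss.1, h⟩
    · rw [e2 s h]; exact hsk _ ⟨by linarith, by linarith [hss.2]⟩
  · rw [e1 0 hT, hΩ0]
  · rw [e2 _ (by linarith)]; congr 1; ring
  · intro i hi j
    rcases Nat.lt_succ_iff_lt_or_eq.1 hi with h | h
    · obtain ⟨c, hc⟩ := hu i h j
      refine ⟨c, fun s hss => ?_⟩
      rw [ta i (by omega), ta (i + 1) (by omega)] at hss
      have : s ≤ T := hss.2.le.trans (hle' (i + 1) (by omega))
      rw [← hc s hss]
      exact if_pos this
    · subst h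
      refine ⟨κ j, fun s hss => ?_⟩
      rw [ta i le_rfl, tb, htk] at hss
      exact if_neg (not_le.2 hss.1)
  · intro i hi s hss
    rcases Nat.lt_succ_iff_lt_or_eq.1 hi with h | h
    · rw [ta i (by omega), ta (i + 1) (by omega)] at hss
      have hsT : s < T := hss.2.trans_le (hle' (i + 1) (by omega))
      obtain ⟨D, hD1, hD2⟩ := hder i h s hss
      refine ⟨D, fun p q => ?_, ?_⟩
      · refine (hD1 p q).congr_of_eventuallyEq ?_
        filter_upwards [Iio_mem_nhds hsT] with r hr
        rw [e1 r (le_of_lt hr)]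
      · rw [e1 s hsT.le, hD2]
        congr 1
        refine Finset.sum_congr rfl fun j _ => ?_
        have : u' j s = u j s := if_pos hsT.le
        rw [this]
    · subst h
      rw [ta i le_rfl, tb, htk] at hss
      obtain ⟨D, hD1, hD2⟩ := hD (s - T) ⟨by linarith [hss.1], by linarith [hss.2]⟩
      refine ⟨D, fun p q => ?_, ?_⟩
      · have := (hD1 p q).comp_sub_const s T
        refine this.congr_of_eventuallyEq ?_
        filter_upwards [Ioi_mem_nhds hss.1] with r hr
        rw [e2 r (le_of_lt hr)]
      · rw [e2 s hss.1.le, hD2]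
        congr 1
        refine Finset.sum_congr rfl fun j _ => ?_
        have : u' j s = κ j := if_neg (not_le.2 hss.1)
        rw [this]

end Append

section Eigen

lemma eigen_split {V κ : Type*} [AddCommGroup V] [Module ℝ V] [DecidableEq κ]
    (S : Submodule ℝ V) (M : V →ₗ[ℝ] V) (hM : ∀ v ∈ S, M v ∈ S) (l : κ → ℝ) (s : Finset κ) :
    ∀ (v : κ → V), (∀ i ∈ s, ∀ j ∈ s, l i = l j → i = j) → (∀ k ∈ s, M (v k) = l k • v k) →
      ∑ k ∈ s, v k ∈ S → ∀ k ∈ s, v k ∈ S := by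
  induction s using Finset.induction_on with
  | empty => simp
  | insert j s hj ih =>
    intro v hl hv hsum
    have h1 : ∀ k ∈ s, (l k - l j) • v k ∈ S := by
      refine ih (fun k => (l k - l j) • v k)
        (fun i hi i' hi' => hl i (Finset.mem_insert_of_mem hi) i' (Finset.mem_insert_of_mem hi')) ?_ ?_
      · intro k hk
        rw [map_smul, hv k (Finset.mem_insert_of_mem hk), smul_comm]
      · have h2 : M (∑ k ∈ insert j s, v k) - l j • (∑ k ∈ insert j s, v k) =
            ∑ k ∈ s, (l k - l j) • v k := by
          rw [Finset.sum_insert hj, map_add, map_sum, hv j (Finset.mem_insert_self _ _), smul_add,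
            Finset.smul_sum, add_sub_add_left_eq_sub, ← Finset.sum_sub_distrib]
          refine Finset.sum_congr rfl fun k hk => ?_
          rw [hv k (Finset.mem_insert_of_mem hk), sub_smul]
        rw [← h2]
        exact S.sub_mem (hM _ hsum) (S.smul_mem _ hsum)
    have h3 : ∀ k ∈ s, v k ∈ S := by
      intro k hk
      have hne : l k - l j ≠ 0 := by
        intro h0
        have := hl k (Finset.mem_insert_of_mem hk) j (Finset.mem_insert_self _ _) (sub_eq_zero.1 h0)
        exact hj (this ▸ hk)
      have := S.smul_mem (l k - l j)⁻¹ (h1 k hk)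
      rwa [smul_smul, inv_mul_cancel₀ hne, one_smul] at this
    intro k hk
    rcases Finset.mem_insert.1 hk with rfl | hk
    · rw [Finset.sum_insert hj] at hsum
      exact (S.add_mem_iff_left (S.sum_mem h3)).1 hsum
    · exact h3 k hk

end Eigen

end MRB

namespace MRB

open Filter Topology

section Algebra

attribute [local instance] Matrix.normedAddCommGroup Matrix.normedSpace

/-- The space `so(n)`. -/
def so (n : ℕ) : Submodule ℝ (Mat n) where
  carrier := {X | Xᵀ = -X}
  zero_mem' := by simp
  add_mem' := by
    intro X Y hX hY
    simp only [mem_setOf_eq] at hX hY ⊢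
    rw [transpose_add, hX, hY, neg_add]
  smul_mem' := by
    intro r X hX
    simp only [mem_setOf_eq] at hX ⊢
    rw [transpose_smul, hX, smul_neg]

variable {n : ℕ}

/-- structure constants -/
noncomputable def aij (c : Fin n → ℝ) (i j : Fin n) : ℝ := (c i - c j) / (c i + c j)

lemma aij_swap (c : Fin n → ℝ) (i j : Fin n) : aij c j i = -aij c i j := by
  unfold aij
  rw [add_comm (c j), ← neg_div, neg_sub]

lemma so_apply (X : so n) (i j : Fin n) : (X : Mat n) j i = -(X : Mat n) i j :=
  congrFun (congrFun X.2 i) j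

/-- the bilinear operator in matrix form -/
noncomputable def bmat (c : Fin n → ℝ) (X Y : Mat n) : Mat n :=
  Matrix.of fun i j => aij c i j / 2 * ((X * Y + Y * X) i j)

/-- the bilinear operator on `so(n)` -/
noncomputable def Bso (c : Fin n → ℝ) : so n →ₗ[ℝ] so n →ₗ[ℝ] so n :=
  LinearMap.mk₂ ℝ (fun X Y => ⟨bmat c X Y, by
      have h : ((X : Mat n) * (Y : Mat n) + (Y : Mat n) * (X : Mat n))ᵀ =
          (X : Mat n) * (Y : Mat n) + (Y : Mat n) * (X : Mat n) := by
        rw [transpose_add, transpose_mul, transpose_mul, show (X : Mat n)ᵀ = -X from X.2,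
          show (Y : Mat n)ᵀ = -Y from Y.2]
        simp [add_comm]
      change (bmat c X Y)ᵀ = -bmat c X Y
      ext i j
      have h' := congrFun (congrFun h i) j
      rw [transpose_apply] at h'
      simp only [bmat, transpose_apply, of_apply, Matrix.neg_apply, h', aij_swap c i j]
      ring⟩)
    (by
      intro x y z
      ext i j
      simp [bmat, add_mul, mul_add]
      ring)
    (by
      intro r x y
      ext i j
      simp [bmat]
      ring)
    (by
      intro x y z
      ext i j
      simp [bmat, add_mul, mul_add]
      ring)
    (by
      intro r x y
      ext i j
      simp [bmat]
      ring)

lemma Bso_coe (c : Fin n → ℝ) (X Y : so n) : (Bso c X Y : Mat n) = bmat c X Y := rfl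

lemma Bso_symm (c : Fin n → ℝ) (X Y : so n) : Bso c X Y = Bso c Y X := by
  ext i j
  simp only [Bso_coe, bmat, add_comm]

/-- elementary skew matrices -/
def Eso (i j : Fin n) : so n := ⟨single i j 1 - single j i 1, by
  change (single i j 1 - single j i 1 : Mat n)ᵀ = -(single i j 1 - single j i 1)
  simp⟩

lemma Eso_swap (i j : Fin n) : Eso j i = -Eso i j := by
  ext
  simp [Eso]

lemma Eso_self (i : Fin n) : Eso i i = 0 := by
  ext
  simp [Eso]

lemma Bso_E {c : Fin n → ℝ} {i j k : Fin n} (hij : i ≠ j) (hjk : j ≠ k) (hik : i ≠ k) :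
    Bso c (Eso i j) (Eso j k) = (aij c i k / 2) • Eso i k := by
  have h : (Eso i j : Mat n) * (Eso j k : Mat n) + (Eso j k : Mat n) * (Eso i j : Mat n) =
      single i k 1 + single k i 1 := by
    simp [Eso, sub_mul, mul_sub, single_mul_single_of_ne, hij, hij.symm, hjk, hjk.symm, hik, hik.symm]
  ext p q
  rw [Bso_coe, bmat, of_apply, h]
  simp only [Eso, SetLike.val_smul, Matrix.smul_apply, Matrix.sub_apply, Matrix.add_apply, single_apply, smul_eq_mul]
  by_cases h1 : i = p ∧ k = q
  · obtain ⟨rfl, rfl⟩ := h1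
    simp [hik, hik.symm]
  · by_cases h2 : k = p ∧ i = q
    · obtain ⟨rfl, rfl⟩ := h2
      simp [hik, hik.symm, aij_swap c i k]
      ring
    · simp [h1, h2]

lemma Bso_EE {c : Fin n → ℝ} (i j : Fin n) : Bso c (Eso i j) (Eso i j) = 0 := by
  by_cases hij : i = j
  · subst hij
    rw [Eso_self]; simp
  have h : (Eso i j : Mat n) * (Eso i j : Mat n) = -(single i i 1 + single j j 1) := by
    simp [Eso, sub_mul, mul_sub, single_mul_single_of_ne, hij, Ne.symm hij]
    abel
  ext p q
  rw [Bso_coe, bmat, of_apply, h]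
  by_cases hpq : p = q
  · subst hpq; simp [aij]
  · have h1 : ¬ (i = p ∧ i = q) := by rintro ⟨rfl, rfl⟩; exact hpq rfl
    have h2 : ¬ (j = p ∧ j = q) := by rintro ⟨rfl, rfl⟩; exact hpq rfl
    simp [single_apply, h1, h2]

lemma so_eq_sum (X : so n) : X = ∑ i, ∑ j, ((X : Mat n) i j / 2) • Eso i j := by
  ext p q
  simp only [Submodule.coe_sum, SetLike.val_smul, Matrix.sum_apply, Matrix.smul_apply, Eso, Matrix.sub_apply,
    single_apply, smul_eq_mul]
  simp only [mul_sub, Finset.sum_sub_distrib, ite_and, mul_ite, mul_one, mul_zero]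
  simp [so_apply X p q]
  ring

lemma aij_ne {c : Fin n → ℝ} (hc : ∀ i, 0 < c i) (hinj : Function.Injective c) {i j : Fin n}
    (h : i ≠ j) : aij c i j ≠ 0 :=
  div_ne_zero (sub_ne_zero.2 (fun e => h (hinj e))) (by linarith [hc i, hc j])

lemma eig_inj {x y p q : ℝ} (hp : 0 < p) (hq : 0 < q) (hpx : p < x) (hqx : q < x) (hpy : p < y)
    (hqy : q < y)
    (h : (p - x) / (p + x) * ((q - x) / (q + x)) = (p - y) / (p + y) * ((q - y) / (q + y))) :
    x = y := by
  have hx : 0 < x := hp.trans hpx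
  have hy : 0 < y := hp.trans hpy
  rw [div_mul_div_comm, div_mul_div_comm, div_eq_div_iff (by positivity) (by positivity)] at h
  have h2 : (x - y) * ((p + q) * (x * y - p * q)) = 0 := by nlinarith [h]
  have h3 : p * q < x * y := mul_lt_mul'' hpx hqy hp.le hq.le
  have h4 : (p + q) * (x * y - p * q) ≠ 0 := by
    have : 0 < x * y - p * q := by linarith
    positivity
  exact sub_eq_zero.1 ((mul_eq_zero.1 h2).resolve_right h4)

/-- the second torque direction -/
def g2 (i0 i1 : Fin n) : so n := ∑ k ∈ Finset.univ.filter (fun k => k ≠ i0 ∧ k ≠ i1), Eso i0 k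

lemma gen_so {c : Fin n → ℝ} (hc : ∀ i, 0 < c i) (hinj : Function.Injective c) {i0 i1 : Fin n}
    (h01 : i0 ≠ i1) (hmin : ∀ k, k ≠ i0 → k ≠ i1 → c i0 < c k ∧ c i1 < c k)
    (S : Submodule ℝ (so n)) (h1 : Eso i0 i1 ∈ S) (h2 : g2 i0 i1 ∈ S)
    (hS : ∀ w ∈ S, ∀ v ∈ S, Bso c w w = 0 → Bso c w v ∈ S) : S = ⊤ := by
  have hT : ∀ v ∈ S, Bso c (Eso i0 i1) v ∈ S := fun v hv => hS _ h1 v hv (Bso_EE _ _)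
  have hE0 : ∀ k, k ≠ i0 → k ≠ i1 → Eso i0 k ∈ S := by
    have := eigen_split S ((Bso c (Eso i0 i1)).comp (Bso c (Eso i0 i1)))
      (fun v hv => hT _ (hT v hv)) (fun k => -(aij c i0 k * aij c i1 k) / 4)
      (Finset.univ.filter (fun k => k ≠ i0 ∧ k ≠ i1)) (fun k => Eso i0 k) ?_ ?_ h2
    · intro k hk hk'
      exact this k (by simp [hk, hk'])
    · intro i hi j hj hij
      simp only [Finset.mem_filter, Finset.mem_univ, true_and] at hi hj
      have h3 : aij c i0 i * aij c i1 i = aij c i0 j * aij c i1 j := by linarith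
      obtain ⟨a1, a2⟩ := hmin i hi.1 hi.2
      obtain ⟨a3, a4⟩ := hmin j hj.1 hj.2
      exact hinj (eig_inj (hc i0) (hc i1) a1 a2 a3 a4 h3)
    · intro k hk
      simp only [Finset.mem_filter, Finset.mem_univ, true_and] at hk
      have e1 : Bso c (Eso i0 i1) (Eso i0 k) = -((aij c i1 k / 2) • Eso i1 k) := by
        rw [Eso_swap i1 i0, map_neg, LinearMap.neg_apply, Bso_E h01.symm hk.1.symm hk.2.symm]
      rw [LinearMap.comp_apply, e1, map_neg, map_smul, Bso_E h01 hk.2.symm hk.1.symm, smul_smul,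
        ← neg_smul]
      congr 1
      ring
  have hE0' : ∀ k, Eso i0 k ∈ S := by
    intro k
    by_cases hk : k = i0
    · rw [hk, Eso_self]; exact S.zero_mem
    by_cases hk1 : k = i1
    · rw [hk1]; exact h1
    exact hE0 k hk hk1
  have hall : ∀ i j, Eso i j ∈ S := by
    intro i j
    by_cases hi : i = i0
    · rw [hi]; exact hE0' j
    by_cases hj : j = i0
    · rw [hj, Eso_swap]; exact S.neg_mem (hE0' i)
    by_cases hij : i = j
    · rw [hij, Eso_self]; exact S.zero_mem
    have h3 : Eso i i0 ∈ S := by rw [Eso_swap]; exact S.neg_mem (hE0' i)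
    have h4 := hS _ h3 _ (hE0' j) (Bso_EE _ _)
    rw [Bso_E hi (Ne.symm hj) hij] at h4
    have h5 := S.smul_mem (aij c i j / 2)⁻¹ h4
    rwa [smul_smul, inv_mul_cancel₀ (div_ne_zero (aij_ne hc hinj hij) two_ne_zero), one_smul] at h5
  rw [eq_top_iff]
  intro X _
  rw [so_eq_sum X]
  exact S.sum_mem fun i _ => S.sum_mem fun j _ => S.smul_mem _ (hall i j)

end Algebra

end MRB

namespace MRB

open Filter Topology

section Final

attribute [local instance] Matrix.normedAddCommGroup Matrix.normedSpace

variable {n : ℕ}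

lemma IC_add (C X Y : Mat n) : IC C (X + Y) = IC C X + IC C Y := by
  simp only [IC, add_mul, mul_add]; abel

lemma IC_smul (C X : Mat n) (r : ℝ) : IC C (r • X) = r • IC C X := by
  simp only [IC, Matrix.smul_mul, Matrix.mul_smul, smul_add]

lemma IC_conj {P D : Mat n} (hP : Pᵀ * P = 1) (X : Mat n) :
    IC (P * D * Pᵀ) (P * X * Pᵀ) = P * IC D X * Pᵀ := by
  have h : ∀ Y Z : Mat n, P * Y * Pᵀ * (P * Z * Pᵀ) = P * (Y * Z) * Pᵀ := by
    intro Y Z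
    calc P * Y * Pᵀ * (P * Z * Pᵀ) = P * Y * (Pᵀ * P) * Z * Pᵀ := by simp only [Matrix.mul_assoc]
      _ = P * (Y * Z) * Pᵀ := by rw [hP, Matrix.mul_one]; simp only [Matrix.mul_assoc]
  simp only [IC, h, mul_add, add_mul]

lemma mbracket_conj {P D : Mat n} (hP : Pᵀ * P = 1) (X : Mat n) :
    mbracket (P * D * Pᵀ) ((P * X * Pᵀ) ^ 2) = P * mbracket D (X ^ 2) * Pᵀ := by
  have h : ∀ Y Z : Mat n, P * Y * Pᵀ * (P * Z * Pᵀ) = P * (Y * Z) * Pᵀ := by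
    intro Y Z
    calc P * Y * Pᵀ * (P * Z * Pᵀ) = P * Y * (Pᵀ * P) * Z * Pᵀ := by simp only [Matrix.mul_assoc]
      _ = P * (Y * Z) * Pᵀ := by rw [hP, Matrix.mul_one]; simp only [Matrix.mul_assoc]
  simp only [mbracket, pow_two, h, mul_sub, sub_mul]

lemma IC_diag {c : Fin n → ℝ} (hc : ∀ i, 0 < c i) (X : Mat n) :
    IC (diagonal c) (bmat c X X) = mbracket (diagonal c) (X ^ 2) := by
  ext i j
  have : c i + c j ≠ 0 := by linarith [hc i, hc j]
  simp only [IC, mbracket, pow_two, Matrix.add_apply, Matrix.sub_apply, mul_diagonal, diagonal_mul,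
    bmat, of_apply, aij]
  field_simp
  ring

/-- the conjugation -/
def iota (P : Mat n) (X : Mat n) : Mat n := P * X * Pᵀ

lemma iota_add (P X Y : Mat n) : iota P (X + Y) = iota P X + iota P Y := by
  simp [iota, mul_add, add_mul]

lemma iota_smul (P X : Mat n) (r : ℝ) : iota P (r • X) = r • iota P X := by
  simp [iota]

lemma iota_skew (P : Mat n) (X : so n) : IsSkew (iota P X) := by
  unfold IsSkew iota
  rw [transpose_mul, transpose_mul, transpose_transpose, show (X : Mat n)ᵀ = -X from X.2]
  simp [Matrix.mul_assoc]

/-- the bilinear operator, continuous -/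
noncomputable def BL (c : Fin n → ℝ) : so n →L[ℝ] so n →L[ℝ] so n :=
  (Bso c).toContinuousBilinearMap

lemma equation {P : Mat n} (hP : Pᵀ * P = 1) {c : Fin n → ℝ} (hc : ∀ i, 0 < c i) (ν : ℝ)
    (x u : so n) :
    IC (P * diagonal c * Pᵀ) (iota P (fq (BL c) (-ν) x + u : so n)) =
      mbracket (P * diagonal c * Pᵀ) ((iota P x) ^ 2) - ν • IC (P * diagonal c * Pᵀ) (iota P x) +
        IC (P * diagonal c * Pᵀ) (iota P u) := by
  have h1 : ((fq (BL c) (-ν) x + u : so n) : Mat n) = bmat c x x + (-ν) • (x : Mat n) + u := rfl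
  rw [h1, iota_add, iota_add, IC_add, IC_add, iota_smul, IC_smul]
  have h2 : IC (P * diagonal c * Pᵀ) (iota P (bmat c x x)) =
      mbracket (P * diagonal c * Pᵀ) ((iota P x) ^ 2) := by
    rw [iota, IC_conj hP, IC_diag hc, iota, mbracket_conj hP]
  rw [h2, neg_smul, sub_eq_add_neg]

lemma steers_of_reach {P : Mat n} (hP : Pᵀ * P = 1) {c : Fin n → ℝ} (hc : ∀ i, 0 < c i) (ν : ℝ)
    (g h : so n) {x y : so n} (hr : Reach (fq (BL c) (-ν)) (Submodule.span ℝ {g, h}) x y) :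
    Steers (P * diagonal c * Pᵀ) ν ![iota P g, iota P h] (iota P x) (iota P y) := by
  induction hr with
  | refl => exact steers_refl (iota_skew P x)
  | tail _ hs ih =>
    obtain ⟨τ, hτ, u, hu, γ, hγ, rfl, rfl⟩ := hs
    obtain ⟨α, β, rfl⟩ := Submodule.mem_span_pair.1 hu
    have hmaps : MapsTo (fun s : ℝ => s / τ) (Icc 0 τ) (Icc 0 1) := fun s hs =>
      ⟨div_nonneg hs.1 hτ.le, (div_le_one hτ).2 hs.2⟩
    have hio : Continuous (fun X : so n => iota P X) := by
      unfold iota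
      fun_prop
    have := steers_append (ω := fun s => iota P (γ (s / τ))) ih hτ ![α, β] ?_ ?_ ?_ ?_
    · simpa [div_self hτ.ne'] using this
    · exact hio.comp_continuousOn (hγ.continuousOn.comp (by fun_prop) hmaps)
    · exact fun s _ => iota_skew P _
    · simp
    · intro s hs
      refine ⟨iota P (fq (BL c) (-ν) (γ (s / τ)) + (α • g + β • h) : so n), ?_, ?_⟩
      · intro p q
        have hs' : s / τ ∈ Ioo (0 : ℝ) 1 := ⟨div_pos hs.1 hτ, (div_lt_one hτ).2 hs.2⟩
        have h1 := (hγ (s / τ) ⟨hs'.1.le, hs'.2.le⟩).hasDerivAt (Icc_mem_nhds hs'.1 hs'.2)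
        have h2 : HasDerivAt (fun r : ℝ => r / τ) (1 / τ) s := (hasDerivAt_id s).div_const τ
        have h3 := h1.scomp s h2
        rw [smul_smul, one_div, inv_mul_cancel₀ hτ.ne', one_smul] at h3
        let L : so n →ₗ[ℝ] ℝ :=
          { toFun := fun X => iota P X p q
            map_add' := by
              intro X Y
              rw [Submodule.coe_add, iota_add]; rfl
            map_smul' := by
              intro r X
              rw [Submodule.coe_smul, iota_smul]; rfl }
        have h4 := (LinearMap.toContinuousLinearMap L).hasFDerivAt.comp_hasDerivAt s h3
        exact h4
      · rw [equation hP hc]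
        congr 1
        rw [Submodule.coe_add, Submodule.coe_smul, Submodule.coe_smul, iota_add, IC_add, iota_smul,
          iota_smul, IC_smul, IC_smul]
        simp

lemma exists_two_min (hn : 3 ≤ n) {c : Fin n → ℝ} (hinj : Function.Injective c) :
    ∃ i0 i1 : Fin n, i0 ≠ i1 ∧ ∀ k, k ≠ i0 → k ≠ i1 → c i0 < c k ∧ c i1 < c k := by
  have : NeZero n := ⟨by omega⟩
  obtain ⟨i0, -, h0⟩ := Finset.exists_min_image (Finset.univ : Finset (Fin n)) c ⟨0, by simp⟩
  have hne : (Finset.univ.erase i0).Nonempty := by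
    rw [← Finset.card_pos, Finset.card_erase_of_mem (Finset.mem_univ _), Finset.card_univ,
      Fintype.card_fin]
    omega
  obtain ⟨i1, hi1, h1⟩ := Finset.exists_min_image (Finset.univ.erase i0) c hne
  refine ⟨i0, i1, (Finset.ne_of_mem_erase hi1).symm, fun k hk0 hk1 => ⟨?_, ?_⟩⟩
  · exact lt_of_le_of_ne (h0 k (Finset.mem_univ _)) (fun e => hk0 (hinj e).symm)
  · exact lt_of_le_of_ne (h1 k (Finset.mem_erase.2 ⟨hk0, Finset.mem_univ _⟩))
      (fun e => hk1 (hinj e).symm)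

theorem main_diag (hn : 3 ≤ n) {P : Mat n} (hP : Pᵀ * P = 1) {c : Fin n → ℝ} (hc : ∀ i, 0 < c i)
    (hinj : Function.Injective c) (ν : ℝ) :
    ∃ G1 G2 : Mat n, IsSkew G1 ∧ IsSkew G2 ∧
      ∀ Ω₀ Ω₁ : Mat n, IsSkew Ω₀ → IsSkew Ω₁ →
        Steers (P * diagonal c * Pᵀ) ν ![G1, G2] Ω₀ Ω₁ := by
  obtain ⟨i0, i1, h01, hmin⟩ := exists_two_min hn hinj
  refine ⟨iota P (Eso i0 i1), iota P (g2 i0 i1), iota_skew P _, iota_skew P _, ?_⟩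
  intro Ω₀ Ω₁ h0 h1
  have hP' : P * Pᵀ = 1 := mul_eq_one_comm.1 hP
  have hlift : ∀ Ω : Mat n, IsSkew Ω → ∃ x : so n, iota P x = Ω := by
    intro Ω hΩ
    have hΩ' : Ω ∈ so n := hΩ
    refine ⟨⟨iota Pᵀ Ω, iota_skew Pᵀ ⟨Ω, hΩ'⟩⟩, ?_⟩
    simp only [iota, transpose_transpose]
    calc P * (Pᵀ * Ω * P) * Pᵀ = (P * Pᵀ) * Ω * (P * Pᵀ) := by simp only [Matrix.mul_assoc]
      _ = Ω := by rw [hP', Matrix.one_mul, Matrix.mul_one]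
  obtain ⟨x, rfl⟩ := hlift Ω₀ h0
  obtain ⟨y, rfl⟩ := hlift Ω₁ h1
  apply steers_of_reach hP hc
  apply reach_all
  · exact Bso_symm c
  · intro S hU hS
    refine gen_so hc hinj h01 hmin S (hU (Submodule.subset_span (by simp)))
      (hU (Submodule.subset_span (by simp))) hS

end Final

end MRB

/-- **Theorem 1 (global controllability of the MRB by two torques).**
For `n ≥ 3`, a real symmetric positive definite `C` with distinct eigenvalues and
damping `ν ≥ 0`, there exist skew-symmetric directions `G¹, G²` such that the controlled
Euler–Frahm system `I_C(Ω̇) = [C, Ω²] − ν I_C(Ω) + u₁ I_C(G¹) + u₂ I_C(G²)` is globally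
controllable on `so(n)` by piecewise constant controls. -/
theorem mrb_global_controllability_two_torques
    (n : ℕ) (hn : 3 ≤ n) (C : Mat n) (hC : C.PosDef)
    (hdist : Function.Injective hC.1.eigenvalues) (ν : ℝ) (hν : 0 ≤ ν) :
    ∃ G1 G2 : Mat n, IsSkew G1 ∧ IsSkew G2 ∧
      ∀ Ω₀ Ω₁ : Mat n, IsSkew Ω₀ → IsSkew Ω₁ →
        Steers C ν ![G1, G2] Ω₀ Ω₁ := by
  have hP : ((hC.1.eigenvectorUnitary : Mat n))ᵀ * (hC.1.eigenvectorUnitary : Mat n) = 1 :=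
    (Unitary.mem_iff.1 hC.1.eigenvectorUnitary.2).1
  have hspec : C = (hC.1.eigenvectorUnitary : Mat n) * diagonal hC.1.eigenvalues *
      ((hC.1.eigenvectorUnitary : Mat n))ᵀ := by
    have := hC.1.spectral_theorem
    rw [Unitary.conjStarAlgAut_apply] at this
    exact this
  have := MRB.main_diag hn hP hC.eigenvalues_pos hdist ν
  rw [← hspec] at this
  exact this
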